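/- Let n ≥ 1, let p⃗=(p_1,…,p_n), q⃗=(q_1,…,q_n) satisfy 1<p_i<∞, 1<q_i<∞ for all i, and let 0<s<n/p_i for every i=1,…,n. Then there exists a constant C>0 such that for all Schwartz functions f on ℝⁿ, ‖ f(x)/|x|^s ‖_{L^{p⃗,q⃗}(ℝⁿ)} ≤ C ‖ Λ^s f ‖_{L^{p⃗,q⃗}(ℝⁿ)}. -/

import Mathlib

open MeasureTheory ENNReal Real Set

noncomputable section

/-- The decreasing rearrangement of an `ℝ≥0∞`-valued function. -/
def rearr {α : Type*} [MeasurableSpace α] (μ : Measure α) (f : α → ℝ≥0∞) (t : ℝ) : ℝ≥0∞ :=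
  sInf {s : ℝ≥0∞ | μ {x | s < f x} ≤ ENNReal.ofReal t}

/-- The Lorentz `L^{p,q}` quasi-norm, `‖f‖_{p,q} = ‖ t^{1/p} f*(t) ‖_{L^q((0,∞),dt/t)}`,
with `q = ∞` giving the weak-`L^p` quasi-norm. -/
def lorentzNorm {α : Type*} [MeasurableSpace α] (μ : Measure α) (p q : ℝ≥0∞)
    (f : α → ℝ≥0∞) : ℝ≥0∞ :=
  if q = ∞ then ⨆ t ∈ Set.Ioi (0 : ℝ), ENNReal.ofReal t ^ p⁻¹.toReal * rearr μ f t
  else (∫⁻ t in Set.Ioi (0 : ℝ),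
      (ENNReal.ofReal t ^ p⁻¹.toReal * rearr μ f t) ^ q.toReal / ENNReal.ofReal t) ^ q⁻¹.toReal

/-- Mixed (anisotropic) Lorentz quasi-norm on `ℝⁿ`: the Lorentz quasi-norm is taken
iteratively in each coordinate, with the coordinate `x 0` innermost. -/
def mixedLorentz : (n : ℕ) → (Fin n → ℝ≥0∞) → (Fin n → ℝ≥0∞) →
    ((Fin n → ℝ) → ℝ≥0∞) → ℝ≥0∞
  | 0, _, _, f => f (fun i => i.elim0)
  | n + 1, p, q, f => mixedLorentz n (fun i => p i.succ) (fun i => q i.succ)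
      (fun y => lorentzNorm (volume : Measure ℝ) (p 0) (q 0) (fun x => f (Fin.cons x y)))

/-- Mixed (anisotropic) Lebesgue norm on `ℝⁿ`, coordinate `x 0` innermost. -/
def mixedLp : (n : ℕ) → (Fin n → ℝ) → ((Fin n → ℝ) → ℝ≥0∞) → ℝ≥0∞
  | 0, _, f => f (fun i => i.elim0)
  | n + 1, p, f => mixedLp n (fun i => p i.succ)
      (fun y => (∫⁻ x : ℝ, (f (Fin.cons x y)) ^ (p 0)) ^ (1 / p 0))

/-- The Fourier transform on `ℝⁿ`, normalized as `(2π)^{-n/2} ∫ f(x) e^{-i ξ·x} dx`. -/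
def ft (n : ℕ) (f : (Fin n → ℝ) → ℂ) (ξ : Fin n → ℝ) : ℂ :=
  (((2 * π) ^ (-(n : ℝ) / 2) : ℝ) : ℂ) *
    ∫ x : Fin n → ℝ, Complex.exp (-(Complex.I * ((∑ i, ξ i * x i : ℝ) : ℂ))) * f x

/-- `Λ^s` acting only in the coordinates of `S`: the Fourier multiplier with symbol
`(∑_{i ∈ S} |ξ i|²)^{s/2}`. -/
def fracLapOn (n : ℕ) (S : Finset (Fin n)) (s : ℝ) (f : (Fin n → ℝ) → ℂ)
    (x : Fin n → ℝ) : ℂ :=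
  ft n (fun ξ => ((((∑ i ∈ S, ξ i ^ 2) ^ (s / 2) : ℝ)) : ℂ) * ft n f ξ) (-x)

/-- The fractional Laplacian `Λ^s = (−Δ)^{s/2}`. -/
def fracLap (n : ℕ) (s : ℝ) (f : (Fin n → ℝ) → ℂ) : (Fin n → ℝ) → ℂ :=
  fracLapOn n Finset.univ s f

theorem hs_rearr_le_iff {α : Type*} [MeasurableSpace α] (μ : Measure α) (f : α → ℝ≥0∞) (t : ℝ)
    (s : ℝ≥0∞) : rearr μ f t ≤ s ↔ μ {x | s < f x} ≤ ENNReal.ofReal t := by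
  constructor
  · intro h
    by_cases hs : s = ∞
    · subst hs; simp
    · obtain ⟨u, hu, hus, hlim⟩ := exists_seq_strictAnti_tendsto' (lt_top_iff_ne_top.2 hs)
      have hset : {x | s < f x} = ⋃ n, {x | u n < f x} := by
        ext x
        simp only [mem_ofPred_eq, mem_iUnion]
        constructor
        · intro hx
          exact (hlim.eventually (gt_mem_nhds hx)).exists
        · rintro ⟨n, hn⟩
          exact (hus n).1.trans hn
      rw [hset, Monotone.measure_iUnion]
      · refine iSup_le fun n => ?_
        obtain ⟨r, hr, hru⟩ := sInf_lt_iff.1 (lt_of_le_of_lt h (hus n).1)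
        refine le_trans (measure_mono ?_) hr
        intro x hx
        exact lt_trans hru hx
      · intro m n hmn x hx
        exact lt_of_le_of_lt (hu.antitone hmn) hx
  · intro h
    exact sInf_le h

theorem hs_lt_rearr_iff {α : Type*} [MeasurableSpace α] (μ : Measure α) (f : α → ℝ≥0∞) (t : ℝ)
    (s : ℝ≥0∞) : s < rearr μ f t ↔ ENNReal.ofReal t < μ {x | s < f x} := by
  rw [← not_le, ← not_le, hs_rearr_le_iff]

theorem hs_rearr_anti {α : Type*} [MeasurableSpace α] (μ : Measure α) (f : α → ℝ≥0∞) :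
    Antitone (rearr μ f) := by
  intro a b hab
  rw [hs_rearr_le_iff]
  exact ((hs_rearr_le_iff μ f a _).1 le_rfl).trans (ENNReal.ofReal_le_ofReal hab)

theorem hs_rearr_mono {α : Type*} [MeasurableSpace α] {μ : Measure α} {f g : α → ℝ≥0∞}
    (h : ∀ᵐ x ∂μ, f x ≤ g x) (t : ℝ) : rearr μ f t ≤ rearr μ g t := by
  rw [hs_rearr_le_iff]
  refine le_trans (measure_mono_ae ?_) ((hs_rearr_le_iff μ g t _).1 le_rfl)
  filter_upwards [h] with x hx hx2
  exact lt_of_lt_of_le hx2 hx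

theorem hs_rearr_measurable {α β : Type*} [MeasurableSpace α] [MeasurableSpace β] {μ : Measure α}
    [SFinite μ] {F : β → α → ℝ≥0∞} (hF : Measurable (Function.uncurry F)) :
    Measurable (fun z : β × ℝ => rearr μ (F z.1) z.2) := by
  refine measurable_of_Iic fun s => ?_
  have : (fun z : β × ℝ => rearr μ (F z.1) z.2) ⁻¹' Iic s
      = {z : β × ℝ | μ {x | s < F z.1 x} ≤ ENNReal.ofReal z.2} := by
    ext z
    simp [hs_rearr_le_iff]
  rw [this]
  refine measurableSet_le ?_ (by fun_prop)
  have h1 : MeasurableSet {z : β × α | s < F z.1 z.2} :=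
    measurableSet_lt measurable_const hF
  have h2 := measurable_measure_prodMk_left (ν := μ) h1
  exact h2.comp measurable_fst

theorem hs_rearr_measurable1 {α : Type*} [MeasurableSpace α] {μ : Measure α} {f : α → ℝ≥0∞} :
    Measurable (rearr μ f) := (hs_rearr_anti μ f).measurable

theorem hs_layer (c : ℝ≥0∞) :
    ∫⁻ l in Ioi (0 : ℝ), {l : ℝ | ENNReal.ofReal l < c}.indicator 1 l = c := by
  have hm : MeasurableSet {l : ℝ | ENNReal.ofReal l < c} :=
    measurableSet_lt (by fun_prop) measurable_const
  rw [lintegral_indicator_one hm, Measure.restrict_apply hm]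
  by_cases hc : c = ∞
  · subst hc
    simp
  · have : {l : ℝ | ENNReal.ofReal l < c} ∩ Ioi 0 = Ioo 0 c.toReal := by
      ext l
      simp only [mem_inter_iff, mem_ofPred_eq, mem_Ioi, mem_Ioo]
      constructor
      · rintro ⟨h1, h2⟩
        exact ⟨h2, (ENNReal.ofReal_lt_iff_lt_toReal h2.le hc).1 h1⟩
      · rintro ⟨h1, h2⟩
        exact ⟨(ENNReal.ofReal_lt_iff_lt_toReal h1.le hc).2 h2, h1⟩
    rw [this]
    simp [hc]

theorem hs_layer_lintegral {α : Type*} [MeasurableSpace α] {μ : Measure α} [SFinite μ]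
    {f : α → ℝ≥0∞} (hf : Measurable f) :
    ∫⁻ x, f x ∂μ = ∫⁻ l in Ioi (0 : ℝ), μ {x | ENNReal.ofReal l < f x} := by
  calc ∫⁻ x, f x ∂μ
      = ∫⁻ x, (∫⁻ l in Ioi (0 : ℝ), {l : ℝ | ENNReal.ofReal l < f x}.indicator 1 l) ∂μ := by
        simp_rw [hs_layer]
    _ = ∫⁻ l in Ioi (0 : ℝ), ∫⁻ x, {l : ℝ | ENNReal.ofReal l < f x}.indicator 1 l ∂μ := by
        refine lintegral_lintegral_swap (Measurable.aemeasurable ?_)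
        have h1 : MeasurableSet {z : α × ℝ | ENNReal.ofReal z.2 < f z.1} :=
          measurableSet_lt (by fun_prop) (by fun_prop)
        have h2 : Measurable ({z : α × ℝ | ENNReal.ofReal z.2 < f z.1}.indicator
          (1 : α × ℝ → ℝ≥0∞)) := measurable_one.indicator h1
        convert h2 using 1
        funext z
        rfl
    _ = _ := by
        refine lintegral_congr fun l => ?_
        rw [← lintegral_indicator_one (measurableSet_lt measurable_const hf)]
        rfl

theorem hs_setLIntegral_le_rearr {α : Type*} [MeasurableSpace α] {μ : Measure α} [SFinite μ]
    {f : α → ℝ≥0∞} (hf : Measurable f) (E : Set α) :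
    ∫⁻ x in E, f x ∂μ ≤ ∫⁻ t in Ioi (0 : ℝ) ∩ {t : ℝ | ENNReal.ofReal t < μ E}, rearr μ f t := by
  rw [hs_layer_lintegral hf, hs_layer_lintegral hs_rearr_measurable1]
  refine lintegral_mono fun l => ?_
  simp only [hs_lt_rearr_iff]
  have hm : MeasurableSet {x : ℝ | ENNReal.ofReal x < μ {x | ENNReal.ofReal l < f x}} :=
    measurableSet_lt (by fun_prop) measurable_const
  have hm2 : MeasurableSet {x : ℝ | ENNReal.ofReal x < μ E} :=
    measurableSet_lt (by fun_prop) measurable_const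
  rw [Measure.restrict_apply hm, Measure.restrict_apply (measurableSet_lt measurable_const hf)]
  set A := {x | ENNReal.ofReal l < f x}
  have h3 : MeasurableSet {x : ℝ | ENNReal.ofReal x < μ (A ∩ E)} :=
    measurableSet_lt (by fun_prop) measurable_const
  calc μ (A ∩ E) = ∫⁻ l in Ioi (0 : ℝ), {l : ℝ | ENNReal.ofReal l < μ (A ∩ E)}.indicator 1 l :=
        (hs_layer _).symm
    _ = volume ({l : ℝ | ENNReal.ofReal l < μ (A ∩ E)} ∩ Ioi 0) := by
        rw [lintegral_indicator_one h3, Measure.restrict_apply h3]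
    _ ≤ _ := by
        refine measure_mono ?_
        rintro x ⟨hx, hx0⟩
        exact ⟨lt_of_lt_of_le hx (measure_mono inter_subset_left), hx0,
          lt_of_lt_of_le hx (measure_mono inter_subset_right)⟩

theorem hs_dil (ψ : ℝ → ℝ≥0∞) {v : ℝ} (hv : 0 < v) :
    ∫⁻ t in Ioi (0 : ℝ), ψ (t * v) = (ENNReal.ofReal v)⁻¹ * ∫⁻ t in Ioi (0 : ℝ), ψ t := by
  have e : MeasurableEmbedding (fun t : ℝ => t * v) :=
    (Homeomorph.mulRight₀ v hv.ne').measurableEmbedding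
  have h := e.lintegral_map (μ := volume) ((Ioi (0 : ℝ)).indicator ψ)
  rw [Real.map_volume_mul_right hv.ne', lintegral_smul_measure,
    lintegral_indicator measurableSet_Ioi, abs_of_pos (inv_pos.2 hv),
    ENNReal.ofReal_inv_of_pos hv] at h
  rw [← lintegral_indicator measurableSet_Ioi, ← smul_eq_mul, h]
  refine lintegral_congr fun t => ?_
  by_cases ht : 0 < t
  · simp [indicator, ht, mul_pos ht hv]
  · have : ¬ (0 < t * v) := by
      rw [mul_pos_iff_of_pos_right hv]; exact ht
    simp [indicator, ht, this]

theorem hs_dil_Ioo (ψ : ℝ → ℝ≥0∞) {v : ℝ} (hv : 0 < v) :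
    ∫⁻ t in Ioo (0 : ℝ) 1, ψ (t * v) = (ENNReal.ofReal v)⁻¹ * ∫⁻ t in Ioo (0 : ℝ) v, ψ t := by
  have h := hs_dil ((Iio v).indicator ψ) hv
  have e1 : ∀ w : ℝ, Ioo 0 w = Iio w ∩ Ioi 0 := fun w => by
    ext x; simp [and_comm]
  rw [lintegral_indicator measurableSet_Iio, Measure.restrict_restrict measurableSet_Iio,
    ← e1 v] at h
  rw [← h, e1 1, ← Measure.restrict_restrict measurableSet_Iio,
    ← lintegral_indicator measurableSet_Iio]
  refine lintegral_congr fun t => ?_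
  by_cases ht : t < 1
  · have : t * v < v := by nlinarith
    simp [indicator, ht, this]
  · have : ¬ (t * v < v) := by
      push Not at ht ⊢; nlinarith
    simp [indicator, ht, this]

/-- Key estimate: the rearrangement of a superposition. -/
theorem hs_rearr_superpos {α β : Type*} [MeasurableSpace α] [MeasurableSpace β] {μ : Measure α}
    [SigmaFinite μ] {ν : Measure β} [SFinite ν] {F : β → α → ℝ≥0∞}
    (hF : Measurable (Function.uncurry F)) {t : ℝ} (ht : 0 < t) :
    rearr μ (fun x => ∫⁻ u, F u x ∂ν) t
      ≤ ∫⁻ u, (∫⁻ v in Ioo (0 : ℝ) 1, rearr μ (F u) (t * v)) ∂ν := by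
  refine le_of_forall_lt fun l hl => ?_
  obtain ⟨l', hl', hl2⟩ := exists_between hl
  refine lt_of_lt_of_le hl' ?_
  rw [hs_lt_rearr_iff] at hl2
  have hFm : Measurable (fun x => ∫⁻ u, F u x ∂ν) := by
    have : Measurable (Function.uncurry fun x u => F u x) := hF.comp measurable_swap
    exact this.lintegral_prod_right
  obtain ⟨E, hEm, hEs, hE1, hE2⟩ := Measure.exists_subset_measure_lt_top
    (measurableSet_lt measurable_const hFm) hl2
  set M := (μ E).toReal with hM
  have hME : ENNReal.ofReal M = μ E := ENNReal.ofReal_toReal hE2.ne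
  have htM : t < M := by
    rw [← hME] at hE1
    exact (ENNReal.ofReal_lt_ofReal_iff_of_nonneg ht.le).1 hE1
  have hM0 : 0 < M := ht.trans htM
  have hset : Ioi (0 : ℝ) ∩ {t : ℝ | ENNReal.ofReal t < μ E} = Ioo 0 M := by
    ext x
    simp only [mem_inter_iff, mem_Ioi, mem_ofPred_eq, mem_Ioo, and_congr_right_iff]
    intro hx
    rw [← hME, ENNReal.ofReal_lt_ofReal_iff_of_nonneg hx.le]
  have h1 : l' * μ E ≤ ∫⁻ x in E, ∫⁻ u, F u x ∂ν ∂μ := by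
    rw [← setLIntegral_const]
    exact setLIntegral_mono hFm fun x hx => (hEs hx).le
  have h2 : ∫⁻ x in E, ∫⁻ u, F u x ∂ν ∂μ = ∫⁻ u, ∫⁻ x in E, F u x ∂μ ∂ν := by
    refine lintegral_lintegral_swap (Measurable.aemeasurable ?_)
    exact hF.comp measurable_swap
  have h3 : ∀ u, ∫⁻ x in E, F u x ∂μ
      ≤ μ E * ∫⁻ v in Ioo (0 : ℝ) 1, rearr μ (F u) (t * v) := by
    intro u
    refine (hs_setLIntegral_le_rearr (hF.comp measurable_prodMk_left) E).trans ?_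
    rw [hset]
    have h4 := hs_dil_Ioo (rearr μ (F u)) hM0
    have h5 : ∫⁻ t in Ioo (0 : ℝ) M, rearr μ (F u) t
        = μ E * ∫⁻ v in Ioo (0 : ℝ) 1, rearr μ (F u) (v * M) := by
      rw [h4, hME, ← mul_assoc, ENNReal.mul_inv_cancel, one_mul]
      · rw [← hME]; simpa using hM0
      · exact hE2.ne
    change ∫⁻ t in Ioo (0 : ℝ) M, rearr μ (F u) t ≤ _
    rw [h5]
    gcongr 1
    refine setLIntegral_mono' measurableSet_Ioo fun v hv => hs_rearr_anti _ _ ?_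
    rw [mul_comm]
    exact mul_le_mul_of_nonneg_left htM.le hv.1.le
  have hmeas : Measurable fun u => ∫⁻ v in Ioo (0 : ℝ) 1, rearr μ (F u) (t * v) := by
    have := (hs_rearr_measurable (μ := μ) hF).comp
      (measurable_fst.prodMk (measurable_snd.const_mul t) : Measurable fun z : β × ℝ => (z.1, t * z.2))
    exact Measurable.lintegral_prod_right (f := fun (u : β) (v : ℝ) => rearr μ (F u) (t * v)) this
  have h6 : l' * μ E ≤ (∫⁻ u, (∫⁻ v in Ioo (0 : ℝ) 1, rearr μ (F u) (t * v)) ∂ν) * μ E := by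
    refine h1.trans ?_
    rw [h2, mul_comm, ← lintegral_const_mul _ hmeas]
    exact lintegral_mono h3
  refine (ENNReal.mul_le_mul_iff_left ?_ hE2.ne).1 h6
  rw [← hME]; simpa using hM0

theorem hs_minkowski {α β : Type*} [MeasurableSpace α] [MeasurableSpace β] {μ : Measure α}
    [SFinite μ] {ν : Measure β} [SFinite ν] {F : α → β → ℝ≥0∞}
    (hF : Measurable (Function.uncurry F)) {q : ℝ} (hq : 1 < q) :
    (∫⁻ x, (∫⁻ y, F x y ∂ν) ^ q ∂μ) ^ (1 / q) ≤ ∫⁻ y, (∫⁻ x, F x y ^ q ∂μ) ^ (1 / q) ∂ν := by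
  have hq0 : 0 < q := by linarith
  set A : β → ℝ≥0∞ := fun y => (∫⁻ x, F x y ^ q ∂μ) ^ (1 / q) with hA
  have hFs : Measurable (Function.uncurry fun y x => F x y) := hF.comp measurable_swap
  have hAm : Measurable A := by
    have : Measurable (Function.uncurry fun y x => F x y ^ q) := hFs.pow_const q
    exact (this.lintegral_prod_right).pow_const _
  have hAq : ∀ y, A y ^ q = ∫⁻ x, F x y ^ q ∂μ := fun y => by
    simp only [hA]
    rw [← ENNReal.rpow_mul, one_div_mul_cancel hq0.ne', ENNReal.rpow_one]
  set Z := ∫⁻ y, A y ∂ν with hZ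
  by_cases hZt : Z = ∞
  · rw [hZt]; exact le_top
  have hAfin : ∀ᵐ y ∂ν, A y < ∞ := ae_lt_top hAm hZt
  have hzero : ∀ y, ∀ᵐ x ∂μ, A y = 0 → F x y = 0 := by
    intro y
    by_cases hy : A y = 0
    · have h1 : ∫⁻ x, F x y ^ q ∂μ = 0 := by
        rw [← hAq, hy, ENNReal.zero_rpow_of_pos hq0]
      have hm : Measurable fun x => F x y ^ q := (hF.comp measurable_prodMk_right).pow_const q
      rw [lintegral_eq_zero_iff hm] at h1
      filter_upwards [h1] with x hx _
      simpa [hq0, hq0.not_gt] using hx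
    · exact Filter.Eventually.of_forall fun x h => absurd h hy
  have hzero2 : ∀ᵐ x ∂μ, ∀ᵐ y ∂ν, A y = 0 → F x y = 0 := by
    have hms : MeasurableSet {z : β × α | A z.1 = 0 → F z.2 z.1 = 0} := by
      have h1 : MeasurableSet {z : β × α | A z.1 = 0} :=
        (hAm.comp measurable_fst) (measurableSet_singleton 0)
      have h2 : MeasurableSet {z : β × α | F z.2 z.1 = 0} :=
        hFs (measurableSet_singleton 0)
      exact h1.himp h2
    exact (Measure.ae_ae_comm (μ := ν) (ν := μ) hms).1 (Filter.Eventually.of_forall hzero)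
  have hpt : ∀ᵐ x ∂μ, (∫⁻ y, F x y ∂ν) ^ q
      ≤ (∫⁻ y, F x y ^ q * A y ^ (1 - q) ∂ν) * Z ^ (q - 1) := by
    filter_upwards [hzero2] with x hx
    have hFx : Measurable (F x) := hF.comp measurable_prodMk_left
    have hpq : q.HolderConjugate (q / (q - 1)) := Real.HolderConjugate.conjExponent hq
    have h1 : ∫⁻ y, F x y ∂ν
        = ∫⁻ y, ((fun y => F x y * A y ^ ((1 - q) / q)) * (fun y => A y ^ ((q - 1) / q))) y ∂ν := by
      refine lintegral_congr_ae ?_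
      filter_upwards [hx, hAfin] with y hy hyf
      simp only [Pi.mul_apply]
      by_cases h0 : A y = 0
      · simp [hy h0]
      · rw [mul_assoc, ← ENNReal.rpow_add _ _ h0 hyf.ne]
        have : (1 - q) / q + (q - 1) / q = 0 := by ring
        rw [this, ENNReal.rpow_zero, mul_one]
    have h2 := ENNReal.lintegral_mul_le_Lp_mul_Lq ν hpq
      (f := fun y => F x y * A y ^ ((1 - q) / q)) (g := fun y => A y ^ ((q - 1) / q))
      (hFx.mul (hAm.pow_const _)).aemeasurable (hAm.pow_const _).aemeasurable
    rw [← h1] at h2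
    have h3 : ∀ y, (F x y * A y ^ ((1 - q) / q)) ^ q = F x y ^ q * A y ^ (1 - q) := fun y => by
      rw [ENNReal.mul_rpow_of_nonneg _ _ hq0.le, ← ENNReal.rpow_mul, div_mul_cancel₀ _ hq0.ne']
    have hq1 : q - 1 ≠ 0 := by linarith
    have h4 : ∀ y, (A y ^ ((q - 1) / q)) ^ (q / (q - 1)) = A y := fun y => by
      rw [← ENNReal.rpow_mul]
      have : (q - 1) / q * (q / (q - 1)) = 1 := by field_simp
      rw [this, ENNReal.rpow_one]
    simp only [h3, h4] at h2
    have h5 := ENNReal.rpow_le_rpow h2 hq0.le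
    refine h5.trans (le_of_eq ?_)
    rw [ENNReal.mul_rpow_of_nonneg _ _ hq0.le, ← ENNReal.rpow_mul, ← ENNReal.rpow_mul]
    have e1 : 1 / q * q = 1 := by field_simp
    have e2 : 1 / (q / (q - 1)) * q = q - 1 := by field_simp
    rw [e1, e2, ENNReal.rpow_one]
  have hfin : ∫⁻ x, (∫⁻ y, F x y ∂ν) ^ q ∂μ ≤ Z ^ q := by
    have hm : Measurable (Function.uncurry fun x y => F x y ^ q * A y ^ (1 - q)) :=
      (hF.pow_const q).mul ((hAm.comp measurable_snd).pow_const _)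
    calc ∫⁻ x, (∫⁻ y, F x y ∂ν) ^ q ∂μ
        ≤ ∫⁻ x, (∫⁻ y, F x y ^ q * A y ^ (1 - q) ∂ν) * Z ^ (q - 1) ∂μ := lintegral_mono_ae hpt
      _ = (∫⁻ x, ∫⁻ y, F x y ^ q * A y ^ (1 - q) ∂ν ∂μ) * Z ^ (q - 1) :=
          lintegral_mul_const _ hm.lintegral_prod_right
      _ = (∫⁻ y, ∫⁻ x, F x y ^ q * A y ^ (1 - q) ∂μ ∂ν) * Z ^ (q - 1) := by
          rw [lintegral_lintegral_swap hm.aemeasurable]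
      _ ≤ Z * Z ^ (q - 1) := by
          gcongr
          refine lintegral_mono fun y => ?_
          have hFy : Measurable fun x => F x y ^ q :=
            (hF.comp measurable_prodMk_right).pow_const q
          rw [lintegral_mul_const _ hFy, ← hAq]
          by_cases h0 : A y = 0
          · rw [h0, ENNReal.zero_rpow_of_pos hq0]; simp
          · by_cases ht : A y = ∞
            · rw [ht]; exact le_top
            · rw [← ENNReal.rpow_add _ _ h0 ht]
              simp
      _ = Z ^ q := by
          by_cases h0 : Z = 0
          · rw [h0, ENNReal.zero_rpow_of_pos hq0, zero_mul]
          · conv_lhs => rw [← ENNReal.rpow_one Z, ← ENNReal.rpow_mul, ← ENNReal.rpow_add _ _ h0 hZt]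
            congr 1; ring
  calc _ ≤ (Z ^ q) ^ (1 / q) := ENNReal.rpow_le_rpow hfin (by positivity)
    _ = Z := by rw [← ENNReal.rpow_mul, mul_one_div_cancel hq0.ne', ENNReal.rpow_one]

/-- weighted `L^q` form of the Lorentz functional. -/
def hsN (p q : ℝ) (r : ℝ → ℝ≥0∞) : ℝ≥0∞ :=
  (∫⁻ t in Ioi (0 : ℝ), (ENNReal.ofReal t ^ (1 / p - 1 / q) * r t) ^ q) ^ (1 / q)

theorem hs_lorentz_eq {α : Type*} [MeasurableSpace α] (μ : Measure α) {p q : ℝ}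
    (hp : 1 < p) (hq : 1 < q) (f : α → ℝ≥0∞) :
    lorentzNorm μ (ENNReal.ofReal p) (ENNReal.ofReal q) f = hsN p q (rearr μ f) := by
  have hp0 : 0 < p := by linarith
  have hq0 : 0 < q := by linarith
  unfold lorentzNorm hsN
  rw [if_neg ENNReal.ofReal_ne_top, ← ENNReal.ofReal_inv_of_pos hp0,
    ← ENNReal.ofReal_inv_of_pos hq0, ENNReal.toReal_ofReal (by positivity),
    ENNReal.toReal_ofReal (by positivity), ENNReal.toReal_ofReal (by positivity), one_div q]
  congr 1
  refine setLIntegral_congr_fun measurableSet_Ioi fun t ht => ?_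
  have h0 : ENNReal.ofReal t ≠ 0 := by simpa using ht
  have htop : ENNReal.ofReal t ≠ ∞ := ENNReal.ofReal_ne_top
  rw [ENNReal.mul_rpow_of_nonneg _ _ hq0.le, ENNReal.mul_rpow_of_nonneg _ _ hq0.le,
    ← ENNReal.rpow_mul, ← ENNReal.rpow_mul, ENNReal.div_eq_inv_mul, ← mul_assoc,
    ← ENNReal.rpow_neg_one, ← ENNReal.rpow_add _ _ h0 htop]
  congr 2
  field_simp
  ring

theorem hsN_mono {p q : ℝ} (hq : 1 < q) {r r' : ℝ → ℝ≥0∞} (h : ∀ t, 0 < t → r t ≤ r' t) :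
    hsN p q r ≤ hsN p q r' := by
  unfold hsN
  refine ENNReal.rpow_le_rpow (setLIntegral_mono' measurableSet_Ioi fun t ht => ?_) (by positivity)
  refine ENNReal.rpow_le_rpow ?_ (by positivity)
  gcongr
  exact h t ht

theorem hsN_const {p q : ℝ} (hq : 1 < q) (c : ℝ≥0∞) (hc : c ≠ ∞) (r : ℝ → ℝ≥0∞) :
    hsN p q (fun t => c * r t) = c * hsN p q r := by
  have hq0 : 0 < q := by linarith
  unfold hsN
  have : ∀ t : ℝ, (ENNReal.ofReal t ^ (1 / p - 1 / q) * (c * r t)) ^ q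
      = c ^ q * (ENNReal.ofReal t ^ (1 / p - 1 / q) * r t) ^ q := fun t => by
    rw [← ENNReal.mul_rpow_of_nonneg _ _ hq0.le]; congr 1; ring
  simp only [this]
  rw [lintegral_const_mul' _ _ (ENNReal.rpow_ne_top_of_nonneg hq0.le hc),
    ENNReal.mul_rpow_of_nonneg _ _ (by positivity), ← ENNReal.rpow_mul,
    mul_one_div_cancel hq0.ne', ENNReal.rpow_one]

theorem hsN_dil {p q : ℝ} (hp : 1 < p) (hq : 1 < q) (r : ℝ → ℝ≥0∞) {v : ℝ} (hv : 0 < v) :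
    hsN p q (fun t => r (t * v)) = ENNReal.ofReal v ^ (-(1 / p)) * hsN p q r := by
  have hq0 : 0 < q := by linarith
  have hp0 : 0 < p := by linarith
  have hv0 : ENNReal.ofReal v ≠ 0 := by simpa using hv
  have hvt : ENNReal.ofReal v ≠ ∞ := ENNReal.ofReal_ne_top
  unfold hsN
  set c := ENNReal.ofReal v ^ (-(1 / p - 1 / q)) with hc
  have hct : c ≠ ∞ := ENNReal.rpow_ne_top_of_ne_zero hv0 hvt
  have h1 : ∫⁻ t in Ioi (0 : ℝ), (ENNReal.ofReal t ^ (1 / p - 1 / q) * r (t * v)) ^ q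
      = ∫⁻ t in Ioi (0 : ℝ), c ^ q *
        (fun t => (ENNReal.ofReal t ^ (1 / p - 1 / q) * r t) ^ q) (t * v) := by
    refine setLIntegral_congr_fun measurableSet_Ioi fun t ht => ?_
    have ht0 : ENNReal.ofReal t ≠ 0 := by simpa using ht
    have h2 : ENNReal.ofReal (t * v) ^ (1 / p - 1 / q)
        = ENNReal.ofReal t ^ (1 / p - 1 / q) * ENNReal.ofReal v ^ (1 / p - 1 / q) := by
      rw [ENNReal.ofReal_mul (le_of_lt ht), ENNReal.mul_rpow_of_ne_zero ht0 hv0]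
    simp only
    rw [← ENNReal.mul_rpow_of_nonneg _ _ hq0.le, h2]
    congr 1
    have h3 : c * ENNReal.ofReal v ^ (1 / p - 1 / q) = 1 := by
      rw [hc, ← ENNReal.rpow_add _ _ hv0 hvt]; simp
    calc ENNReal.ofReal t ^ (1 / p - 1 / q) * r (t * v)
        = (c * ENNReal.ofReal v ^ (1 / p - 1 / q)) *
          (ENNReal.ofReal t ^ (1 / p - 1 / q) * r (t * v)) := by rw [h3, one_mul]
      _ = _ := by ring
  rw [h1, lintegral_const_mul' _ _ (ENNReal.rpow_ne_top_of_nonneg hq0.le hct),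
    hs_dil (fun t => (ENNReal.ofReal t ^ (1 / p - 1 / q) * r t) ^ q) hv,
    ENNReal.mul_rpow_of_nonneg _ _ (by positivity), ENNReal.mul_rpow_of_nonneg _ _ (by positivity),
    ← ENNReal.rpow_mul, mul_one_div_cancel hq0.ne', ENNReal.rpow_one, ← mul_assoc, hc,
    ← ENNReal.rpow_neg_one, ← ENNReal.rpow_mul, ← ENNReal.rpow_add _ _ hv0 hvt]
  congr 2
  ring

theorem hs_lorentz_mono {p q : ℝ} (hp : 1 < p) (hq : 1 < q) {f g : ℝ → ℝ≥0∞}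
    (h : ∀ᵐ x, f x ≤ g x) :
    lorentzNorm volume (ENNReal.ofReal p) (ENNReal.ofReal q) f
      ≤ lorentzNorm volume (ENNReal.ofReal p) (ENNReal.ofReal q) g := by
  rw [hs_lorentz_eq _ hp hq, hs_lorentz_eq _ hp hq]
  exact hsN_mono hq fun t _ => hs_rearr_mono h t

theorem hs_rearr_const {α : Type*} [MeasurableSpace α] (μ : Measure α) {c : ℝ≥0∞} (hc0 : c ≠ 0)
    (hc : c ≠ ∞) (f : α → ℝ≥0∞) (t : ℝ) :
    rearr μ (fun x => c * f x) t = c * rearr μ f t := by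
  have key : ∀ s, rearr μ (fun x => c * f x) t ≤ c * s ↔ c * rearr μ f t ≤ c * s := by
    intro s
    rw [hs_rearr_le_iff, ENNReal.mul_le_mul_iff_right hc0 hc, hs_rearr_le_iff]
    simp only [ENNReal.mul_lt_mul_iff_right hc0 hc]
  have key2 : ∀ s, rearr μ (fun x => c * f x) t ≤ s ↔ c * rearr μ f t ≤ s := by
    intro s
    have := key (c⁻¹ * s)
    rwa [← mul_assoc, ENNReal.mul_inv_cancel hc0 hc, one_mul] at this
  exact le_antisymm ((key2 _).2 le_rfl) ((key2 _).1 le_rfl)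

theorem hs_lorentz_const {p q : ℝ} (hp : 1 < p) (hq : 1 < q) {c : ℝ≥0∞} (hc0 : c ≠ 0)
    (hc : c ≠ ∞) (f : ℝ → ℝ≥0∞) :
    lorentzNorm volume (ENNReal.ofReal p) (ENNReal.ofReal q) (fun x => c * f x)
      = c * lorentzNorm volume (ENNReal.ofReal p) (ENNReal.ofReal q) f := by
  rw [hs_lorentz_eq _ hp hq, hs_lorentz_eq _ hp hq, ← hsN_const hq c hc]
  congr 1
  funext t
  exact hs_rearr_const _ hc0 hc f t

theorem hs_rearr_dil (f : ℝ → ℝ≥0∞) {v : ℝ} (hv : v ≠ 0) (t : ℝ) :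
    rearr volume (fun x => f (v * x)) t = rearr volume f (t * |v|) := by
  have hv' : 0 < |v| := abs_pos.2 hv
  have hv0 : ENNReal.ofReal |v| ≠ 0 := by simpa using hv
  have key : ∀ s, rearr volume (fun x => f (v * x)) t ≤ s ↔ rearr volume f (t * |v|) ≤ s := by
    intro s
    rw [hs_rearr_le_iff, hs_rearr_le_iff]
    have : {x | s < f (v * x)} = (fun x => v * x) ⁻¹' {x | s < f x} := rfl
    rw [this, Real.volume_preimage_mul_left hv, ENNReal.ofReal_mul' hv'.le, abs_inv,
      ENNReal.ofReal_inv_of_pos hv', mul_comm, ← div_eq_mul_inv,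
      ENNReal.div_le_iff hv0 ENNReal.ofReal_ne_top]
  exact le_antisymm ((key _).2 le_rfl) ((key _).1 le_rfl)

theorem hs_lorentz_dil {p q : ℝ} (hp : 1 < p) (hq : 1 < q) {v : ℝ} (hv : v ≠ 0) (f : ℝ → ℝ≥0∞) :
    lorentzNorm volume (ENNReal.ofReal p) (ENNReal.ofReal q) (fun x => f (v * x))
      = ENNReal.ofReal |v| ^ (-(1 / p)) *
        lorentzNorm volume (ENNReal.ofReal p) (ENNReal.ofReal q) f := by
  rw [hs_lorentz_eq _ hp hq, hs_lorentz_eq _ hp hq, ← hsN_dil hp hq _ (abs_pos.2 hv)]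
  congr 1
  funext t
  exact hs_rearr_dil f hv t

theorem hs_lorentz_measurable {β : Type*} [MeasurableSpace β] {p q : ℝ} (hp : 1 < p) (hq : 1 < q)
    {F : β → ℝ → ℝ≥0∞} (hF : Measurable (Function.uncurry F)) :
    Measurable fun u => lorentzNorm volume (ENNReal.ofReal p) (ENNReal.ofReal q) (F u) := by
  simp_rw [hs_lorentz_eq _ hp hq]
  unfold hsN
  have h := hs_rearr_measurable (μ := (volume : Measure ℝ)) hF
  have h2 : Measurable (Function.uncurry fun (u : β) (t : ℝ) =>
      (ENNReal.ofReal t ^ (1 / p - 1 / q) * rearr volume (F u) t) ^ q) := by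
    refine (Measurable.mul ?_ h).pow_const q
    exact (ENNReal.measurable_ofReal.comp measurable_snd).pow_const _
  exact h2.lintegral_prod_right.pow_const _

/-- The constant in Minkowski's inequality for the Lorentz quasi-norm. -/
def hsK (p : ℝ) : ℝ≥0∞ := ∫⁻ v in Ioo (0 : ℝ) 1, ENNReal.ofReal v ^ (-(1 / p))

theorem hsK_ne_top {p : ℝ} (hp : 1 < p) : hsK p ≠ ∞ := by
  have hp0 : 0 < p := by linarith
  have h1 : 1 / p < 1 := by rw [div_lt_one hp0]; exact hp
  have h : IntegrableOn (fun v : ℝ => v ^ (-(1 / p))) (Ioo 0 1) :=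
    (intervalIntegral.integrableOn_Ioo_rpow_iff one_pos).2 (by linarith)
  have h2 := h.lintegral_lt_top
  unfold hsK
  refine ne_of_eq_of_ne ?_ h2.ne
  refine setLIntegral_congr_fun measurableSet_Ioo fun v hv => ?_
  exact ENNReal.ofReal_rpow_of_pos hv.1

theorem hs_lorentz_minkowski {β : Type*} [MeasurableSpace β] {ν : Measure β} [SFinite ν]
    {p q : ℝ} (hp : 1 < p) (hq : 1 < q)
    {F : β → ℝ → ℝ≥0∞} (hF : Measurable (Function.uncurry F)) :
    lorentzNorm volume (ENNReal.ofReal p) (ENNReal.ofReal q) (fun x => ∫⁻ u, F u x ∂ν)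
      ≤ hsK p * ∫⁻ u, lorentzNorm volume (ENNReal.ofReal p) (ENNReal.ofReal q) (F u) ∂ν := by
  have hLm := hs_lorentz_measurable hp hq hF
  simp_rw [hs_lorentz_eq _ hp hq] at hLm ⊢
  have hr := hs_rearr_measurable (μ := (volume : Measure ℝ)) hF
  let ρ : Measure ℝ := volume.restrict (Ioo 0 1)
  let G : ℝ → β × ℝ → ℝ≥0∞ := fun t z =>
    ENNReal.ofReal t ^ (1 / p - 1 / q) * rearr volume (F z.1) (t * z.2)
  have hG1 : Measurable (Function.uncurry fun (t : ℝ) (z : β × ℝ) =>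
      rearr volume (F z.1) (t * z.2)) :=
    hr.comp (f := fun w : ℝ × (β × ℝ) => (w.2.1, w.1 * w.2.2)) (by fun_prop)
  have hG : Measurable (Function.uncurry G) :=
    ((ENNReal.measurable_ofReal.comp measurable_fst).pow_const _).mul hG1
  calc hsN p q (rearr volume fun x => ∫⁻ u, F u x ∂ν)
      ≤ hsN p q (fun t => ∫⁻ z, rearr volume (F z.1) (t * z.2) ∂(ν.prod ρ)) := by
        refine hsN_mono hq fun t ht => ?_
        refine (hs_rearr_superpos hF ht).trans (le_of_eq ?_)
        rw [lintegral_prod]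
        exact (hG1.comp measurable_prodMk_left).aemeasurable
    _ = (∫⁻ t in Ioi (0 : ℝ), (∫⁻ z, G t z ∂(ν.prod ρ)) ^ q) ^ (1 / q) := by
        unfold hsN
        congr 1
        refine lintegral_congr fun t => ?_
        have hm : Measurable fun z : β × ℝ => rearr volume (F z.1) (t * z.2) :=
          hG1.comp measurable_prodMk_left
        simp only [G]
        rw [lintegral_const_mul _ hm]
    _ ≤ ∫⁻ z, (∫⁻ t in Ioi (0 : ℝ), G t z ^ q) ^ (1 / q) ∂(ν.prod ρ) := hs_minkowski hG hq
    _ = ∫⁻ z, hsN p q (fun t => rearr volume (F z.1) (t * z.2)) ∂(ν.prod ρ) := rfl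
    _ = ∫⁻ u, ∫⁻ v, hsN p q (fun t => rearr volume (F u) (t * v)) ∂ρ ∂ν := by
        rw [lintegral_prod]
        have : Measurable (Function.uncurry fun (z : β × ℝ) (t : ℝ) => G t z ^ q) :=
          (hG.comp measurable_swap).pow_const q
        exact (this.lintegral_prod_right.pow_const _).aemeasurable
    _ = ∫⁻ u, hsK p * hsN p q (rearr volume (F u)) ∂ν := by
        refine lintegral_congr fun u => ?_
        unfold hsK
        rw [← lintegral_mul_const _ (by fun_prop)]
        exact setLIntegral_congr_fun measurableSet_Ioo fun v hv => hsN_dil hp hq _ hv.1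
    _ = _ := lintegral_const_mul _ hLm

/-- Mixed Lorentz norm with real exponents. -/
def hsML (n : ℕ) (p q : Fin n → ℝ) (f : (Fin n → ℝ) → ℝ≥0∞) : ℝ≥0∞ :=
  mixedLorentz n (fun i => ENNReal.ofReal (p i)) (fun i => ENNReal.ofReal (q i)) f

theorem hsML_zero (p q : Fin 0 → ℝ) (f : (Fin 0 → ℝ) → ℝ≥0∞) :
    hsML 0 p q f = f (fun i => i.elim0) := rfl

theorem hsML_succ (n : ℕ) (p q : Fin (n + 1) → ℝ) (f : (Fin (n + 1) → ℝ) → ℝ≥0∞) :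
    hsML (n + 1) p q f = hsML n (fun i => p i.succ) (fun i => q i.succ)
      (fun y => lorentzNorm (volume : Measure ℝ) (ENNReal.ofReal (p 0)) (ENNReal.ofReal (q 0))
        (fun x => f (Fin.cons x y))) := rfl

theorem hsML_mono : ∀ (n : ℕ) (p q : Fin n → ℝ) (_ : ∀ i, 1 < p i) (_ : ∀ i, 1 < q i)
    (f g : (Fin n → ℝ) → ℝ≥0∞) (_ : ∀ x, (∀ i, x i ≠ 0) → f x ≤ g x),
    hsML n p q f ≤ hsML n p q g
  | 0, p, q, _, _, f, g, h => by
    rw [hsML_zero, hsML_zero]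
    exact h _ fun i => i.elim0
  | n + 1, p, q, hp, hq, f, g, h => by
    rw [hsML_succ, hsML_succ]
    refine hsML_mono n _ _ (fun i => hp _) (fun i => hq _) _ _ fun y hy => ?_
    refine hs_lorentz_mono (hp 0) (hq 0) ?_
    have h0 : ∀ᵐ x : ℝ, x ≠ 0 := by
      simp [ae_iff]
    filter_upwards [h0] with x hx
    refine h _ fun i => ?_
    refine Fin.cases ?_ (fun j => ?_) i
    · simpa using hx
    · simpa using hy j

theorem hsML_const : ∀ (n : ℕ) (p q : Fin n → ℝ) (_ : ∀ i, 1 < p i) (_ : ∀ i, 1 < q i)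
    (c : ℝ≥0∞) (_ : c ≠ 0) (_ : c ≠ ∞) (f : (Fin n → ℝ) → ℝ≥0∞),
    hsML n p q (fun x => c * f x) = c * hsML n p q f
  | 0, p, q, _, _, c, _, _, f => rfl
  | n + 1, p, q, hp, hq, c, hc0, hc, f => by
    rw [hsML_succ, hsML_succ]
    simp_rw [hs_lorentz_const (hp 0) (hq 0) hc0 hc]
    exact hsML_const n _ _ (fun i => hp _) (fun i => hq _) c hc0 hc _

theorem hsML_dil : ∀ (n : ℕ) (p q : Fin n → ℝ) (_ : ∀ i, 1 < p i) (_ : ∀ i, 1 < q i)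
    (v : Fin n → ℝ) (_ : ∀ i, v i ≠ 0) (f : (Fin n → ℝ) → ℝ≥0∞),
    hsML n p q (fun x => f (fun i => v i * x i))
      = (∏ i, ENNReal.ofReal |v i| ^ (-(1 / p i))) * hsML n p q f
  | 0, p, q, _, _, v, _, f => by
    rw [hsML_zero, hsML_zero]
    simp only [Finset.univ_eq_empty, Finset.prod_empty, one_mul]
    congr 1
    funext i
    exact i.elim0
  | n + 1, p, q, hp, hq, v, hv, f => by
    have hv0 : ENNReal.ofReal |v 0| ≠ 0 := by simpa using hv 0
    rw [hsML_succ, hsML_succ]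
    have h1 : ∀ (y : Fin n → ℝ) (x : ℝ), (fun i => v i * (Fin.cons x y : Fin (n + 1) → ℝ) i)
        = (Fin.cons (v 0 * x) (fun j => v j.succ * y j) : Fin (n + 1) → ℝ) := by
      intro y x
      funext i
      refine Fin.cases ?_ (fun j => ?_) i <;> simp
    simp_rw [h1]
    have h2 : ∀ y : Fin n → ℝ, lorentzNorm volume (ENNReal.ofReal (p 0)) (ENNReal.ofReal (q 0))
        (fun x => f (Fin.cons (v 0 * x) (fun j => v j.succ * y j)))
        = ENNReal.ofReal |v 0| ^ (-(1 / p 0)) *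
          (fun y => lorentzNorm volume (ENNReal.ofReal (p 0)) (ENNReal.ofReal (q 0))
            (fun x => f (Fin.cons x y))) (fun j => v j.succ * y j) := fun y =>
      hs_lorentz_dil (hp 0) (hq 0) (hv 0) (fun x => f (Fin.cons x (fun j => v j.succ * y j)))
    simp_rw [h2]
    rw [hsML_const n _ _ (fun i => hp _) (fun i => hq _) _ ?_ ?_ _,
      hsML_dil n _ _ (fun i => hp _) (fun i => hq _) (fun j => v j.succ) (fun j => hv _)
        (fun y => lorentzNorm volume (ENNReal.ofReal (p 0)) (ENNReal.ofReal (q 0))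
            (fun x => f (Fin.cons x y))), Fin.prod_univ_succ, mul_assoc]
    · simp [ENNReal.rpow_eq_zero_iff, hv 0]
    · exact ENNReal.rpow_ne_top_of_ne_zero hv0 ENNReal.ofReal_ne_top

theorem hs_cons_measurable {β : Type*} [MeasurableSpace β] (n : ℕ) {F : β → (Fin (n + 1) → ℝ) → ℝ≥0∞}
    (hF : Measurable (Function.uncurry F)) :
    Measurable (Function.uncurry fun (z : β × (Fin n → ℝ)) (x : ℝ) =>
      F z.1 (Fin.cons x z.2 : Fin (n + 1) → ℝ)) := by
  refine hF.comp (f := fun w : (β × (Fin n → ℝ)) × ℝ =>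
    (w.1.1, (Fin.cons w.2 w.1.2 : Fin (n + 1) → ℝ))) (Measurable.prodMk (by fun_prop) ?_)
  refine measurable_pi_lambda _ fun i => ?_
  refine Fin.cases ?_ (fun j => ?_) i
  · simpa using measurable_snd
  · simp only [Fin.cons_succ]
    fun_prop

theorem hsML_measurable : ∀ (n : ℕ) (p q : Fin n → ℝ) (_ : ∀ i, 1 < p i) (_ : ∀ i, 1 < q i)
    {β : Type} [MeasurableSpace β] (F : β → (Fin n → ℝ) → ℝ≥0∞)
    (_ : Measurable (Function.uncurry F)), Measurable fun u => hsML n p q (F u)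
  | 0, p, q, _, _, β, _, F, hF => by
    simp_rw [hsML_zero]
    exact hF.comp measurable_prodMk_right
  | n + 1, p, q, hp, hq, β, _, F, hF => by
    simp_rw [hsML_succ]
    refine hsML_measurable n _ _ (fun i => hp _) (fun i => hq _) _ ?_
    exact hs_lorentz_measurable (hp 0) (hq 0) (hs_cons_measurable n hF)

theorem hsML_minkowski : ∀ (n : ℕ) (p q : Fin n → ℝ) (_ : ∀ i, 1 < p i) (_ : ∀ i, 1 < q i)
    {β : Type} [MeasurableSpace β] (ν : Measure β) [SFinite ν] (F : β → (Fin n → ℝ) → ℝ≥0∞)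
    (_ : Measurable (Function.uncurry F)),
    hsML n p q (fun x => ∫⁻ u, F u x ∂ν) ≤ (∏ i, (hsK (p i) + 1)) * ∫⁻ u, hsML n p q (F u) ∂ν
  | 0, p, q, _, _, β, _, ν, _, F, hF => by
    simp [hsML_zero]
  | n + 1, p, q, hp, hq, β, _, ν, _, F, hF => by
    simp_rw [hsML_succ]
    have hc := hs_cons_measurable n hF
    have hLm := hs_lorentz_measurable (hp 0) (hq 0) hc
    have h1 : ∀ y : Fin n → ℝ, lorentzNorm volume (ENNReal.ofReal (p 0)) (ENNReal.ofReal (q 0))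
        (fun x => ∫⁻ u, F u (Fin.cons x y) ∂ν) ≤ (hsK (p 0) + 1) * ∫⁻ u,
        lorentzNorm volume (ENNReal.ofReal (p 0)) (ENNReal.ofReal (q 0))
          (fun x => F u (Fin.cons x y)) ∂ν := by
      intro y
      refine (hs_lorentz_minkowski (hp 0) (hq 0) (F := fun u x => F u (Fin.cons x y)) ?_).trans ?_
      · exact hc.comp (f := fun w : β × ℝ => ((w.1, y), w.2)) (by fun_prop)
      · gcongr
        exact le_self_add
    refine (hsML_mono n _ _ (fun i => hp _) (fun i => hq _) _ _ fun y _ => h1 y).trans ?_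
    rw [hsML_const n _ _ (fun i => hp _) (fun i => hq _) _ (by simp)
      (by simp [hsK_ne_top (hp 0)]), Fin.prod_univ_succ, mul_assoc]
    gcongr
    exact hsML_minkowski n _ _ (fun i => hp _) (fun i => hq _) ν
      (fun u y => lorentzNorm volume (ENNReal.ofReal (p 0)) (ENNReal.ofReal (q 0))
          (fun x => F u (Fin.cons x y))) hLm

theorem hs_lintegral_pi_prod : ∀ (n : ℕ) (k : Fin n → ℝ → ℝ≥0∞) (_ : ∀ i, Measurable (k i)),
    ∫⁻ u : Fin n → ℝ, ∏ i, k i (u i) = ∏ i, ∫⁻ x, k i x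
  | 0, k, _ => by
    simp [lintegral_const, volume_pi]
  | n + 1, k, hk => by
    have e := (volume_preserving_piFinSuccAbove (fun _ : Fin (n + 1) => ℝ) 0).symm
    rw [← e.lintegral_comp (by fun_prop)]
    have h1 : ∀ z : ℝ × (Fin n → ℝ), ∏ i, k i
        ((MeasurableEquiv.piFinSuccAbove (fun _ : Fin (n + 1) => ℝ) 0).symm z i)
        = k 0 z.1 * ∏ j : Fin n, k j.succ (z.2 j) := by
      intro z
      rw [Fin.prod_univ_succ]
      simp [MeasurableEquiv.piFinSuccAbove]
    rw [lintegral_congr h1]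
    have hm : Measurable fun y : Fin n → ℝ => ∏ j : Fin n, k j.succ (y j) :=
      Finset.measurable_fun_prod _ fun j _ => (hk _).comp (measurable_pi_apply j)
    rw [Measure.volume_eq_prod, lintegral_prod_mul (hk 0).aemeasurable hm.aemeasurable,
      hs_lintegral_pi_prod n (fun j => k j.succ) (fun j => hk _), Fin.prod_univ_succ]

theorem hs_change_var (n : ℕ) (x : Fin n → ℝ) (hx : ∀ i, x i ≠ 0) (h : (Fin n → ℝ) → ℝ≥0∞)
    (hh : Measurable h) :
    ∫⁻ y, h y = (∏ i, ENNReal.ofReal |x i|) * ∫⁻ u : Fin n → ℝ, h (fun i => x i * u i) := by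
  have hd : (Matrix.diagonal x).det ≠ 0 := by
    rw [Matrix.det_diagonal]; exact Finset.prod_ne_zero_iff.2 fun i _ => hx i
  have := Real.smul_map_diagonal_volume_pi hd
  conv_lhs => rw [← this]
  rw [lintegral_smul_measure, lintegral_map hh, Matrix.det_diagonal, Finset.abs_prod,
    ENNReal.ofReal_prod_of_nonneg (fun i _ => abs_nonneg _), smul_eq_mul]
  · congr 1
    refine lintegral_congr fun u => ?_
    congr 1
    funext i
    simp [Matrix.toLin'_apply, Matrix.mulVec_diagonal]
  · exact (LinearMap.continuous_of_finiteDimensional _).measurable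

theorem hs_hardy_kernel (n : ℕ) (a : ℝ) (x : Fin n → ℝ) (hx : ∀ i, x i ≠ 0)
    (g : (Fin n → ℝ) → ℝ≥0∞) (hg : Measurable g) :
    (∏ i, ENNReal.ofReal |x i| ^ (-a)) *
      ∫⁻ y, (∏ i, ENNReal.ofReal |x i - y i| ^ (a - 1)) * g y
      = ∫⁻ u : Fin n → ℝ, (∏ i, ENNReal.ofReal |1 - u i| ^ (a - 1)) *
          g (fun i => u i * x i) := by
  have hm : ∀ w : Fin n → ℝ, Measurable fun y : Fin n → ℝ =>
      ∏ i, ENNReal.ofReal |w i - y i| ^ (a - 1) := fun w =>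
    Finset.measurable_fun_prod _ fun i _ => by fun_prop
  have hmg : Measurable fun u : Fin n → ℝ => g (fun i => u i * x i) := by
    refine hg.comp (measurable_pi_lambda _ fun i => ?_); fun_prop
  rw [hs_change_var n x hx (fun y => (∏ i, ENNReal.ofReal |x i - y i| ^ (a - 1)) * g y)
    ((hm x).mul hg), ← mul_assoc, ← Finset.prod_mul_distrib]
  rw [← lintegral_const_mul]
  · refine lintegral_congr fun u => ?_
    rw [← mul_assoc, ← Finset.prod_mul_distrib]
    congr 1
    · refine Finset.prod_congr rfl fun i _ => ?_
      have h0 : ENNReal.ofReal |x i| ≠ 0 := by simpa using hx i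
      have ht : ENNReal.ofReal |x i| ≠ ∞ := ENNReal.ofReal_ne_top
      have h1 : x i - x i * u i = x i * (1 - u i) := by ring
      rw [h1, abs_mul, ENNReal.ofReal_mul (abs_nonneg _),
        ENNReal.mul_rpow_of_ne_top ht ENNReal.ofReal_ne_top, ← mul_assoc]
      have h2 : ENNReal.ofReal |x i| ^ (-a) * ENNReal.ofReal |x i| * ENNReal.ofReal |x i| ^ (a - 1)
          = 1 := by
        nth_rewrite 2 [← ENNReal.rpow_one (ENNReal.ofReal |x i|)]
        rw [← ENNReal.rpow_add _ _ h0 ht, ← ENNReal.rpow_add _ _ h0 ht]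
        have : -a + 1 + (a - 1) = 0 := by ring
        rw [this, ENNReal.rpow_zero]
      rw [h2, one_mul]
    · congr 1
      funext i
      ring
  · refine (Finset.measurable_fun_prod _ fun i _ => by fun_prop).mul ?_
    simpa only [mul_comm] using hmg

theorem hs_rpow_neg_anti {x y : ℝ≥0∞} (h : x ≤ y) {c : ℝ} (hc : 0 ≤ c) :
    y ^ (-c) ≤ x ^ (-c) := by
  rw [ENNReal.rpow_neg, ENNReal.rpow_neg]
  exact ENNReal.inv_le_inv.2 (ENNReal.rpow_le_rpow h hc)

theorem hs_psi_fin {c d : ℝ} (hc : c < 1) (hcd : 1 < c + d) :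
    ∫⁻ v : ℝ, ENNReal.ofReal |v| ^ (-c) * ENNReal.ofReal (max |v| (1 / 2)) ^ (-d) ≠ ∞ := by
  set φ : ℝ → ℝ≥0∞ := fun v =>
    ENNReal.ofReal |v| ^ (-c) * ENNReal.ofReal (max |v| (1 / 2)) ^ (-d) with hφ
  have hφm : Measurable φ := by fun_prop
  have hpos : ∫⁻ v in Ioi (0 : ℝ), φ v < ∞ := by
    have hU : Ioi (0 : ℝ) = Ioo 0 (1 / 2) ∪ Ici (1 / 2) := by
      ext x; simp only [mem_Ioi, mem_union, mem_Ioo, mem_Ici]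
      constructor
      · intro h
        rcases lt_or_ge x (1 / 2) with h1 | h1
        · exact Or.inl ⟨h, h1⟩
        · exact Or.inr h1
      · rintro (h | h)
        · exact h.1
        · linarith
    rw [hU]
    refine (lintegral_union_le _ _ _).trans_lt (ENNReal.add_lt_top.2 ⟨?_, ?_⟩)
    · have h : IntegrableOn (fun v : ℝ => v ^ (-c)) (Ioo 0 (1 / 2)) :=
        (intervalIntegral.integrableOn_Ioo_rpow_iff (by norm_num)).2 (by linarith)
      have h2 := h.lintegral_lt_top
      have h3 : ∫⁻ v in Ioo (0 : ℝ) (1 / 2), φ v = (∫⁻ v in Ioo (0 : ℝ) (1 / 2),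
          ENNReal.ofReal (v ^ (-c))) * ENNReal.ofReal (1 / 2) ^ (-d) := by
        rw [← lintegral_mul_const _ (by fun_prop)]
        refine setLIntegral_congr_fun measurableSet_Ioo fun v hv => ?_
        simp only [hφ]
        rw [abs_of_pos hv.1, max_eq_right hv.2.le, ENNReal.ofReal_rpow_of_pos hv.1]
      rw [h3]
      refine ENNReal.mul_lt_top h2 (lt_top_iff_ne_top.2 ?_)
      exact ENNReal.rpow_ne_top_of_ne_zero (by simp) ENNReal.ofReal_ne_top
    · have h : IntegrableOn (fun v : ℝ => v ^ (-c - d)) (Ioi (1 / 4)) :=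
        integrableOn_Ioi_rpow_of_lt (by linarith) (by norm_num)
      have h' := h.mono_set (fun x (hx : x ∈ Ici (1 / 2)) => by
        simp only [mem_Ioi, mem_Ici] at *; linarith : Ici (1 / 2 : ℝ) ⊆ Ioi (1 / 4))
      have h2 := h'.lintegral_lt_top
      refine lt_of_eq_of_lt ?_ h2
      refine setLIntegral_congr_fun measurableSet_Ici fun v hv => ?_
      have hv' : (1 / 2 : ℝ) ≤ v := hv
      have hv0 : 0 < v := by linarith
      have hn : ENNReal.ofReal v ≠ 0 := by simpa using hv0
      simp only [hφ]
      rw [abs_of_pos hv0, max_eq_left hv', ← ENNReal.rpow_add _ _ hn ENNReal.ofReal_ne_top,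
        ENNReal.ofReal_rpow_of_pos hv0]
      rfl
  have hneg : ∫⁻ v in Iio (0 : ℝ), φ v = ∫⁻ v in Ioi (0 : ℝ), φ v := by
    rw [← lintegral_indicator measurableSet_Iio, ← lintegral_indicator measurableSet_Ioi,
      ← lintegral_neg_eq_self]
    refine lintegral_congr fun v => ?_
    simp [indicator, hφ]
  have hall : ∫⁻ v, φ v ≤ (∫⁻ v in Iio (0 : ℝ), φ v) + ∫⁻ v in Ioi (0 : ℝ), φ v := by
    have h0 : ∫⁻ v, φ v = ∫⁻ v in Iio (0 : ℝ) ∪ Ioi 0, φ v := by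
      rw [Iio_union_Ioi]
      exact (setLIntegral_univ φ).symm.trans (setLIntegral_congr
        (ae_eq_univ.2 (by simp : volume (({0}ᶜ : Set ℝ)ᶜ) = 0)).symm)
    rw [h0]
    exact lintegral_union_le _ _ _
  refine (hall.trans_lt ?_).ne
  rw [hneg]
  exact ENNReal.add_lt_top.2 ⟨hpos, hpos⟩

theorem hs_kernel_fin {a b : ℝ} (ha : 0 < a) (hab : a < b) (hb : b < 1) :
    ∫⁻ u : ℝ, ENNReal.ofReal |1 - u| ^ (a - 1) * ENNReal.ofReal |u| ^ (-b) ≠ ∞ := by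
  set φ₁ : ℝ → ℝ≥0∞ := fun v =>
    ENNReal.ofReal |v| ^ (-b) * ENNReal.ofReal (max |v| (1 / 2)) ^ (-(1 - a)) with h1
  set φ₂ : ℝ → ℝ≥0∞ := fun v =>
    ENNReal.ofReal |v| ^ (-(1 - a)) * ENNReal.ofReal (max |v| (1 / 2)) ^ (-b) with h2
  have hm1 : Measurable φ₁ := by fun_prop
  have f1 : ∫⁻ v, φ₁ v ≠ ∞ := hs_psi_fin hb (by linarith)
  have f2 : ∫⁻ v, φ₂ v ≠ ∞ := hs_psi_fin (by linarith) (by linarith)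
  have f3 : ∫⁻ u, φ₂ (1 - u) = ∫⁻ v, φ₂ v := lintegral_sub_left_eq_self φ₂ 1
  have hle : ∀ u : ℝ, ENNReal.ofReal |1 - u| ^ (a - 1) * ENNReal.ofReal |u| ^ (-b)
      ≤ φ₁ u + φ₂ (1 - u) := by
    intro u
    have htri : 1 ≤ |1 - u| + |u| := by
      have := abs_add_le (1 - u) u
      simpa using this
    have e : a - 1 = -(1 - a) := by ring
    rw [e]
    rcases le_total |u| |1 - u| with h | h
    · refine le_trans ?_ le_self_add
      rw [mul_comm]
      simp only [h1]
      have h12 : (1 / 2 : ℝ) ≤ |1 - u| := by linarith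
      exact mul_le_mul' le_rfl
        (hs_rpow_neg_anti (ENNReal.ofReal_le_ofReal (max_le h h12)) (by linarith))
    · refine le_trans ?_ le_add_self
      simp only [h2]
      have h12 : (1 / 2 : ℝ) ≤ |u| := by linarith
      exact mul_le_mul' le_rfl
        (hs_rpow_neg_anti (ENNReal.ofReal_le_ofReal (max_le h h12)) (by linarith))
  refine ((lintegral_mono hle).trans_lt ?_).ne
  rw [lintegral_add_left hm1, f3]
  exact ENNReal.add_lt_top.2 ⟨f1.lt_top, f2.lt_top⟩

theorem hs_main_kernel (n : ℕ) (p q : Fin n → ℝ) (hp : ∀ i, 1 < p i) (hq : ∀ i, 1 < q i)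
    (a : ℝ) (ha : 0 < a) (hap : ∀ i, a < 1 / p i) :
    ∃ K : ℝ≥0∞, K ≠ ∞ ∧ ∀ g : (Fin n → ℝ) → ℝ≥0∞, Measurable g →
      hsML n p q (fun x => (∏ i, ENNReal.ofReal |x i| ^ (-a)) *
        ∫⁻ y, (∏ i, ENNReal.ofReal |x i - y i| ^ (a - 1)) * g y) ≤ K * hsML n p q g := by
  have hp1 : ∀ i, 1 / p i < 1 := fun i => by
    rw [div_lt_one (by linarith [hp i])]; exact hp i
  let κ : Fin n → ℝ → ℝ≥0∞ := fun i u =>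
    ENNReal.ofReal |1 - u| ^ (a - 1) * ENNReal.ofReal |u| ^ (-(1 / p i))
  have hκm : ∀ i, Measurable (κ i) := fun i => by fun_prop
  refine ⟨(∏ i, (hsK (p i) + 1)) * ∏ i, ∫⁻ u, κ i u, ?_, ?_⟩
  · refine ENNReal.mul_ne_top (ENNReal.prod_ne_top fun i _ => ?_) (ENNReal.prod_ne_top fun i _ => ?_)
    · simp [hsK_ne_top (hp i)]
    · exact hs_kernel_fin ha (hap i) (hp1 i)
  · intro g hg
    let F : (Fin n → ℝ) → (Fin n → ℝ) → ℝ≥0∞ := fun u x =>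
      (∏ i, ENNReal.ofReal |1 - u i| ^ (a - 1)) * g (fun i => u i * x i)
    have hF : Measurable (Function.uncurry F) := by
      refine Measurable.mul (f := fun w : (Fin n → ℝ) × (Fin n → ℝ) =>
        ∏ i, ENNReal.ofReal |1 - w.1 i| ^ (a - 1)) (g := fun w => g (fun i => w.1 i * w.2 i)) ?_ ?_
      · exact Finset.measurable_fun_prod _ fun i _ => by fun_prop
      · refine hg.comp (measurable_pi_lambda _ fun i => ?_)
        fun_prop
    have hA := hsML_mono n p q hp hq (fun x => (∏ i, ENNReal.ofReal |x i| ^ (-a)) *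
        ∫⁻ y, (∏ i, ENNReal.ofReal |x i - y i| ^ (a - 1)) * g y)
        (fun x => ∫⁻ u, F u x) (fun x hx => (hs_hardy_kernel n a x hx g hg).le)
    refine hA.trans ((hsML_minkowski n p q hp hq volume F hF).trans ?_)
    rw [mul_assoc]
    refine mul_le_mul_right ?_ _
    have hpm : Measurable fun u : Fin n → ℝ => ∏ i, κ i (u i) :=
      Finset.measurable_fun_prod _ fun i _ => (hκm i).comp (measurable_pi_apply i)
    rw [← hs_lintegral_pi_prod n κ hκm, ← lintegral_mul_const _ hpm]
    refine le_of_eq (lintegral_congr_ae ?_)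
    have hae : ∀ c : ℝ, ∀ᵐ u : Fin n → ℝ, ∀ i, u i ≠ c := by
      intro c
      rw [ae_all_iff]
      intro i
      have : ∀ᵐ x : ℝ, x ≠ c := by simp [ae_iff]
      rw [volume_pi]
      exact (Measure.quasiMeasurePreserving_eval (fun _ : Fin n => (volume : Measure ℝ)) i).ae this
    filter_upwards [hae 0, hae 1] with u h0 h1
    have hc0 : ∀ i, ENNReal.ofReal |1 - u i| ≠ 0 := fun i => by
      have : 1 - u i ≠ 0 := sub_ne_zero.2 (h1 i).symm
      simpa using this
    simp only [F]
    rw [hsML_const n p q hp hq, hsML_dil n p q hp hq u h0 g, ← mul_assoc, ← Finset.prod_mul_distrib]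
    · refine Finset.prod_ne_zero_iff.2 fun i _ => ?_
      simp only [ne_eq, ENNReal.rpow_eq_zero_iff, not_or, not_and]
      exact ⟨fun h => absurd h (hc0 i), fun h => absurd h ENNReal.ofReal_ne_top⟩
    · exact ENNReal.prod_ne_top fun i _ =>
        ENNReal.rpow_ne_top_of_ne_zero (hc0 i) ENNReal.ofReal_ne_top

/-- `|ξ|²` -/
def hsSq {n : ℕ} (x : Fin n → ℝ) : ℝ := ∑ i, x i ^ 2

theorem hsSq_nonneg {n : ℕ} (x : Fin n → ℝ) : 0 ≤ hsSq x := Finset.sum_nonneg fun _ _ => sq_nonneg _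

theorem hsSq_cont {n : ℕ} : Continuous (hsSq : (Fin n → ℝ) → ℝ) := by
  unfold hsSq; fun_prop

theorem hsSq_pos {n : ℕ} {x : Fin n → ℝ} (hx : x ≠ 0) : 0 < hsSq x := by
  refine lt_of_le_of_ne (hsSq_nonneg x) fun h => hx ?_
  have := (Finset.sum_eq_zero_iff_of_nonneg (fun i _ => sq_nonneg (x i))).1 h.symm
  funext i
  simpa using this i (Finset.mem_univ i)

/-- the exponential `e^{i x·ξ}` -/
def hsE {n : ℕ} (x ξ : Fin n → ℝ) : ℂ := Complex.exp (-(Complex.I * ((∑ i, (-x) i * ξ i : ℝ) : ℂ)))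

theorem hsE_norm {n : ℕ} (x ξ : Fin n → ℝ) : ‖hsE x ξ‖ = 1 := by
  unfold hsE
  have : -(Complex.I * ((∑ i, (-x) i * ξ i : ℝ) : ℂ)) = ((-∑ i, (-x) i * ξ i : ℝ) : ℂ) * Complex.I := by
    push_cast; ring
  rw [this, Complex.norm_exp_ofReal_mul_I]

theorem hsE_cont {n : ℕ} : Continuous (fun z : (Fin n → ℝ) × (Fin n → ℝ) => hsE z.1 z.2) := by
  unfold hsE
  refine Complex.continuous_exp.comp ?_
  refine (continuous_const.mul (Complex.continuous_ofReal.comp ?_)).neg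
  refine continuous_finsetSum _ fun i _ => ?_
  simp only [Pi.neg_apply]
  fun_prop

theorem hsE_shift_cont {n : ℕ} (x : Fin n → ℝ) :
    Continuous (fun z : (Fin n → ℝ) × (Fin n → ℝ) => hsE (x + z.1) z.2) := by
  unfold hsE
  refine Complex.continuous_exp.comp ?_
  refine (continuous_const.mul (Complex.continuous_ofReal.comp ?_)).neg
  refine continuous_finsetSum _ fun i _ => ?_
  simp only [Pi.neg_apply, Pi.add_apply]
  fun_prop

theorem hsE_add {n : ℕ} (x y ξ : Fin n → ℝ) : hsE (x + y) ξ = hsE x ξ * hsE y ξ := by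
  unfold hsE
  rw [← Complex.exp_add]
  congr 1
  have : (∑ i, (-(x + y)) i * ξ i : ℝ) = (∑ i, (-x) i * ξ i) + ∑ i, (-y) i * ξ i := by
    rw [← Finset.sum_add_distrib]
    refine Finset.sum_congr rfl fun i _ => ?_
    simp only [Pi.neg_apply, Pi.add_apply]; ring
  rw [this]; push_cast; ring

theorem hs_gauss_int {n : ℕ} {b : ℝ} (hb : 0 < b) :
    Integrable (fun v : Fin n → ℝ => ((Real.exp (-b * hsSq v) : ℝ) : ℂ)) := by
  have h := GaussianFourier.integrable_cexp_neg_mul_sum_add (ι := Fin n) (b := (b : ℂ))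
    (by simpa using hb) (fun _ => 0)
  refine h.congr (Filter.Eventually.of_forall fun v => ?_)
  simp only [hsSq]
  push_cast
  simp

theorem hs_gauss_ft {n : ℕ} {t : ℝ} (ht : 0 < t) (ξ : Fin n → ℝ) :
    ∫ v : Fin n → ℝ, ((Real.exp (-(1 / (4 * t)) * hsSq v) : ℝ) : ℂ) * hsE v ξ
      = (((4 * π * t) ^ ((n : ℝ) / 2) * Real.exp (-t * hsSq ξ) : ℝ) : ℂ) := by
  have hb : 0 < 1 / (4 * t) := by positivity
  have h := GaussianFourier.integral_cexp_neg_mul_sum_add (ι := Fin n) (b := ((1 / (4 * t) : ℝ) : ℂ))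
    (by simpa using hb) (fun i => Complex.I * ξ i)
  have h1 : ∀ v : Fin n → ℝ, ((Real.exp (-(1 / (4 * t)) * hsSq v) : ℝ) : ℂ) * hsE v ξ
      = Complex.exp (-((1 / (4 * t) : ℝ) : ℂ) * ∑ i, (v i : ℂ) ^ 2 + ∑ i, Complex.I * ξ i * v i) := by
    intro v
    rw [Complex.exp_add]
    congr 1
    · rw [Complex.ofReal_exp]
      congr 1
      unfold hsSq
      push_cast
      rfl
    · unfold hsE
      congr 1
      push_cast
      rw [Finset.mul_sum, ← Finset.sum_neg_distrib]
      refine Finset.sum_congr rfl fun i _ => ?_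
      simp only [Pi.neg_apply]
      push_cast; ring
  simp_rw [h1]
  rw [h]
  push_cast
  congr 1
  · rw [Complex.ofReal_cpow (by positivity)]
    simp only [Fintype.card_fin]
    push_cast
    congr 1
    have : (t : ℂ) ≠ 0 := by exact_mod_cast ht.ne'
    field_simp
  · congr 1
    simp only [mul_pow, Complex.I_sq, hsSq]
    push_cast
    rw [← Finset.mul_sum]
    have : (t : ℂ) ≠ 0 := by exact_mod_cast ht.ne'
    field_simp

/-- Gaussian averages of `Ψ = ∫ e^{i y ξ} h(ξ) dξ`. -/
theorem hs_claim1 {n : ℕ} (h : (Fin n → ℝ) → ℂ) (hi : Integrable h) {t : ℝ} (ht : 0 < t)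
    (x : Fin n → ℝ) :
    ∫ v : Fin n → ℝ, ((Real.exp (-(1 / (4 * t)) * hsSq v) : ℝ) : ℂ) * ∫ ξ, hsE (x + v) ξ * h ξ
      = (((4 * π * t) ^ ((n : ℝ) / 2) : ℝ) : ℂ) *
        ∫ ξ, hsE x ξ * ((Real.exp (-t * hsSq ξ) : ℝ) : ℂ) * h ξ := by
  have hb : 0 < 1 / (4 * t) := by positivity
  simp_rw [← integral_const_mul]
  rw [integral_integral_swap]
  · refine integral_congr_ae (Filter.Eventually.of_forall fun ξ => ?_)
    simp only
    have h1 : ∀ v : Fin n → ℝ, ((Real.exp (-(1 / (4 * t)) * hsSq v) : ℝ) : ℂ) * (hsE (x + v) ξ * h ξ)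
        = (hsE x ξ * h ξ) * (((Real.exp (-(1 / (4 * t)) * hsSq v) : ℝ) : ℂ) * hsE v ξ) := fun v => by
      rw [hsE_add]; ring
    simp_rw [h1]
    rw [integral_const_mul, hs_gauss_ft ht]
    push_cast; ring
  · have h2 := (hs_gauss_int (n := n) hb).mul_prod hi
    have h3 := h2.bdd_mul (c := 1) (f := fun z : (Fin n → ℝ) × (Fin n → ℝ) => hsE (x + z.1) z.2)
      ?_ (Filter.Eventually.of_forall fun z => (hsE_norm _ _).le)
    · refine h3.congr (Filter.Eventually.of_forall fun z => ?_)
      simp only [Function.uncurry]; ring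
    · exact (hsE_shift_cont x).aestronglyMeasurable

theorem hs_claim1_norm {n : ℕ} (h : (Fin n → ℝ) → ℂ) (hi : Integrable h) {t : ℝ} (ht : 0 < t)
    (x : Fin n → ℝ) :
    ‖∫ ξ, hsE x ξ * ((Real.exp (-t * hsSq ξ) : ℝ) : ℂ) * h ξ‖ₑ
      ≤ ENNReal.ofReal ((4 * π * t) ^ (-((n : ℝ) / 2))) *
        ∫⁻ y, ENNReal.ofReal (Real.exp (-(1 / (4 * t)) * hsSq (x - y))) * ‖∫ ξ, hsE y ξ * h ξ‖ₑ := by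
  have hpos : 0 < 4 * π * t := by positivity
  have h1 := hs_claim1 h hi ht x
  set J := ∫ ξ, hsE x ξ * ((Real.exp (-t * hsSq ξ) : ℝ) : ℂ) * h ξ
  set c := (4 * π * t) ^ ((n : ℝ) / 2) with hc
  have hcpos : 0 < c := by positivity
  have h2 : ‖((c : ℝ) : ℂ) * J‖ₑ ≤ ∫⁻ v : Fin n → ℝ,
      ENNReal.ofReal (Real.exp (-(1 / (4 * t)) * hsSq v)) * ‖∫ ξ, hsE (x + v) ξ * h ξ‖ₑ := by
    rw [← h1]
    refine (enorm_integral_le_lintegral_enorm _).trans (le_of_eq (lintegral_congr fun v => ?_))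
    rw [enorm_mul]
    congr 1
    rw [← ofReal_norm, Complex.norm_of_nonneg (Real.exp_pos _).le]
  have h3 : ∫⁻ v : Fin n → ℝ,
      ENNReal.ofReal (Real.exp (-(1 / (4 * t)) * hsSq v)) * ‖∫ ξ, hsE (x + v) ξ * h ξ‖ₑ
      = ∫⁻ y, ENNReal.ofReal (Real.exp (-(1 / (4 * t)) * hsSq (x - y))) * ‖∫ ξ, hsE y ξ * h ξ‖ₑ := by
    rw [← lintegral_add_left_eq_self (fun y => ENNReal.ofReal (Real.exp (-(1 / (4 * t)) *
      hsSq (x - y))) * ‖∫ ξ, hsE y ξ * h ξ‖ₑ) x]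
    refine lintegral_congr fun v => ?_
    congr 4
    unfold hsSq
    refine Finset.sum_congr rfl fun i _ => ?_
    simp
  rw [h3, enorm_mul, ← ofReal_norm, Complex.norm_of_nonneg hcpos.le] at h2
  calc ‖J‖ₑ = ENNReal.ofReal ((4 * π * t) ^ (-((n : ℝ) / 2))) * (ENNReal.ofReal c * ‖J‖ₑ) := by
        rw [← mul_assoc, ← ENNReal.ofReal_mul (by positivity), Real.rpow_neg hpos.le,
          inv_mul_cancel₀ hcpos.ne', ENNReal.ofReal_one, one_mul]
    _ ≤ _ := by gcongr

theorem hs_gamma {s r : ℝ} (hs : 0 < s) (hr : 0 < r) :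
    ∫ t in Ioi (0 : ℝ), t ^ (s / 2 - 1) * Real.exp (-t * r) = r ^ (-(s / 2)) * Real.Gamma (s / 2) := by
  have h := Real.integral_rpow_mul_exp_neg_mul_Ioi (a := s / 2) (r := r) (by positivity) hr
  rw [one_div, Real.inv_rpow hr.le, ← Real.rpow_neg hr.le] at h
  rw [← h]
  congr 1
  funext t
  congr 2
  ring

theorem hs_gamma_int {s r : ℝ} (hs : 0 < s) (hr : 0 < r) :
    IntegrableOn (fun t : ℝ => t ^ (s / 2 - 1) * Real.exp (-t * r)) (Ioi 0) := by
  by_contra hcon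
  have h := hs_gamma hs hr
  rw [integral_undef hcon] at h
  have : 0 < r ^ (-(s / 2)) * Real.Gamma (s / 2) :=
    mul_pos (by positivity) (Real.Gamma_pos_of_pos (by positivity))
  linarith

theorem hs_claim2 {n : ℕ} (hn : 1 ≤ n) {s : ℝ} (hs : 0 < s) (φ : (Fin n → ℝ) → ℂ)
    (hφc : Continuous φ) (hφ : Integrable φ) (x : Fin n → ℝ) :
    ((Real.Gamma (s / 2) : ℝ) : ℂ) * ∫ ξ, hsE x ξ * φ ξ
      = ∫ t in Ioi (0 : ℝ), ((t ^ (s / 2 - 1) : ℝ) : ℂ) *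
        ∫ ξ, hsE x ξ * ((Real.exp (-t * hsSq ξ) : ℝ) : ℂ) *
          (((hsSq ξ ^ (s / 2) : ℝ) : ℂ) * φ ξ) := by
  have : Nonempty (Fin n) := ⟨⟨0, hn⟩⟩
  have hΓ : 0 < Real.Gamma (s / 2) := Real.Gamma_pos_of_pos (by positivity)
  have hne : ∀ᵐ ξ : Fin n → ℝ, ξ ≠ 0 := by simp [ae_iff]
  have hEx : Continuous fun ξ : Fin n → ℝ => hsE x ξ :=
    hsE_cont.comp (by fun_prop : Continuous fun ξ : Fin n → ℝ => (x, ξ))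
  have hval : ∀ ξ : Fin n → ℝ, ξ ≠ 0 → ∫ t in Ioi (0 : ℝ), t ^ (s / 2 - 1) *
      Real.exp (-t * hsSq ξ) * hsSq ξ ^ (s / 2) = Real.Gamma (s / 2) := by
    intro ξ hξ
    have hp := hsSq_pos hξ
    rw [integral_mul_const, hs_gamma hs hp, Real.rpow_neg hp.le]
    have : hsSq ξ ^ (s / 2) ≠ 0 := (Real.rpow_pos_of_pos hp _).ne'
    field_simp
  let W : ℝ → (Fin n → ℝ) → ℂ := fun t ξ =>
    ((t ^ (s / 2 - 1) * Real.exp (-t * hsSq ξ) * hsSq ξ ^ (s / 2) : ℝ) : ℂ) * (hsE x ξ * φ ξ)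
  have hWm : Measurable (Function.uncurry W) := by
    have hq : Measurable (hsSq : (Fin n → ℝ) → ℝ) := hsSq_cont.measurable
    have h1 : Measurable fun z : ℝ × (Fin n → ℝ) =>
        (z.1 ^ (s / 2 - 1) * Real.exp (-z.1 * hsSq z.2) * hsSq z.2 ^ (s / 2) : ℝ) := by
      have := hq.comp (measurable_snd : Measurable fun z : ℝ × (Fin n → ℝ) => z.2)
      simp only [Function.comp_def] at this
      fun_prop
    have h2 : Measurable fun z : ℝ × (Fin n → ℝ) => hsE x z.2 * φ z.2 :=
      (hEx.mul hφc).measurable.comp measurable_snd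
    exact (Complex.measurable_ofReal.comp h1).mul h2
  have hWi : Integrable (Function.uncurry W) ((volume.restrict (Ioi 0)).prod volume) := by
    rw [integrable_prod_iff' hWm.aestronglyMeasurable]
    refine ⟨?_, ?_⟩
    · filter_upwards [hne] with ξ hξ
      have h1 := ((hs_gamma_int hs (hsSq_pos hξ)).mul_const (hsSq ξ ^ (s / 2))).ofReal (𝕜 := ℂ)
      exact h1.mul_const (hsE x ξ * φ ξ)
    · have : Integrable fun ξ => Real.Gamma (s / 2) * ‖φ ξ‖ := hφ.norm.const_mul _
      refine this.congr ?_
      filter_upwards [hne] with ξ hξ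
      rw [← hval ξ hξ, ← integral_mul_const]
      refine setIntegral_congr_fun measurableSet_Ioi fun t ht => ?_
      have ht0 : 0 < t := ht
      have hq := hsSq_nonneg ξ
      simp only [Function.uncurry, W]
      rw [norm_mul, norm_mul, hsE_norm, one_mul, Complex.norm_of_nonneg (by positivity)]
  have hL : ((Real.Gamma (s / 2) : ℝ) : ℂ) * ∫ ξ, hsE x ξ * φ ξ
      = ∫ ξ, ∫ t in Ioi (0 : ℝ), W t ξ := by
    rw [← integral_const_mul]
    refine integral_congr_ae ?_
    filter_upwards [hne] with ξ hξ
    simp only [W]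
    rw [integral_mul_const, integral_complex_ofReal, hval ξ hξ]
  rw [hL, ← integral_integral_swap hWi]
  refine setIntegral_congr_fun measurableSet_Ioi fun t ht => ?_
  rw [← integral_const_mul]
  refine integral_congr_ae (Filter.Eventually.of_forall fun ξ => ?_)
  simp only [W]
  push_cast; ring

theorem hs_psi1_fin {s N : ℝ} (h : s < N) :
    ∫⁻ u in Ioi (0 : ℝ), ENNReal.ofReal (u ^ (s / 2 - N / 2 - 1) * Real.exp (-(1 / (4 * u)))) ≠ ∞ := by
  have h1 := hs_gamma_int (s := N - s) (r := 1 / 4) (by linarith) (by norm_num)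
  have h2 := (integrableOn_Ioi_comp_rpow_iff (fun t : ℝ => t ^ ((N - s) / 2 - 1) * Real.exp (-t * (1 / 4)))
    (p := -1) (by norm_num)).2 h1
  have h3 : IntegrableOn (fun u : ℝ => u ^ (s / 2 - N / 2 - 1) * Real.exp (-(1 / (4 * u)))) (Ioi 0) := by
    refine h2.congr_fun (fun u hu => ?_) measurableSet_Ioi
    have hu0 : (0 : ℝ) < u := hu
    simp only [smul_eq_mul, abs_neg, abs_one, one_mul]
    rw [← Real.rpow_mul hu0.le, ← mul_assoc, ← Real.rpow_add hu0, Real.rpow_neg_one]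
    congr 2
    · ring
    · field_simp
  exact h3.lintegral_lt_top.ne

theorem hs_claim3 {n : ℕ} (hn : 1 ≤ n) {s : ℝ} (hsn : s < n) :
    ∃ C : ℝ≥0∞, C ≠ ∞ ∧ ∀ z : Fin n → ℝ, z ≠ 0 →
      ∫⁻ t in Ioi (0 : ℝ), ENNReal.ofReal (t ^ (s / 2 - 1)) *
        (ENNReal.ofReal ((4 * π * t) ^ (-((n : ℝ) / 2))) *
          ENNReal.ofReal (Real.exp (-(1 / (4 * t)) * hsSq z)))
      ≤ C * ∏ i, ENNReal.ofReal |z i| ^ (s / n - 1) := by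
  have hn0 : (0 : ℝ) < n := by exact_mod_cast hn
  refine ⟨ENNReal.ofReal ((4 * π) ^ (-((n : ℝ) / 2))) *
    ∫⁻ u in Ioi (0 : ℝ), ENNReal.ofReal (u ^ (s / 2 - (n : ℝ) / 2 - 1) * Real.exp (-(1 / (4 * u)))),
    ENNReal.mul_ne_top ENNReal.ofReal_ne_top (hs_psi1_fin hsn), fun z hz => ?_⟩
  have hr := hsSq_pos hz
  set r := hsSq z with hrdef
  have hd := hs_dil (fun t => ENNReal.ofReal (t ^ (s / 2 - 1)) *
        (ENNReal.ofReal ((4 * π * t) ^ (-((n : ℝ) / 2))) *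
          ENNReal.ofReal (Real.exp (-(1 / (4 * t)) * r)))) hr
  have hr0 : ENNReal.ofReal r ≠ 0 := by simpa using hr
  have e1 : ∫⁻ t in Ioi (0 : ℝ), ENNReal.ofReal (t ^ (s / 2 - 1)) *
        (ENNReal.ofReal ((4 * π * t) ^ (-((n : ℝ) / 2))) *
          ENNReal.ofReal (Real.exp (-(1 / (4 * t)) * r)))
      = ENNReal.ofReal r * ∫⁻ t in Ioi (0 : ℝ), ENNReal.ofReal ((t * r) ^ (s / 2 - 1)) *
        (ENNReal.ofReal ((4 * π * (t * r)) ^ (-((n : ℝ) / 2))) *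
          ENNReal.ofReal (Real.exp (-(1 / (4 * (t * r))) * r))) := by
    rw [hd, ← mul_assoc, ENNReal.mul_inv_cancel hr0 ENNReal.ofReal_ne_top, one_mul]
  have e2 : ∫⁻ t in Ioi (0 : ℝ), ENNReal.ofReal ((t * r) ^ (s / 2 - 1)) *
        (ENNReal.ofReal ((4 * π * (t * r)) ^ (-((n : ℝ) / 2))) *
          ENNReal.ofReal (Real.exp (-(1 / (4 * (t * r))) * r)))
      = ENNReal.ofReal (r ^ (s / 2 - 1 - (n : ℝ) / 2) * (4 * π) ^ (-((n : ℝ) / 2))) *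
        ∫⁻ u in Ioi (0 : ℝ),
          ENNReal.ofReal (u ^ (s / 2 - (n : ℝ) / 2 - 1) * Real.exp (-(1 / (4 * u)))) := by
    rw [← lintegral_const_mul' _ _ ENNReal.ofReal_ne_top]
    refine setLIntegral_congr_fun measurableSet_Ioi fun t ht => ?_
    have ht0 : (0 : ℝ) < t := ht
    rw [← ENNReal.ofReal_mul (by positivity), ← ENNReal.ofReal_mul (by positivity),
      ← ENNReal.ofReal_mul (by positivity)]
    congr 1
    have a1 : -(1 / (4 * (t * r))) * r = -(1 / (4 * t)) := by field_simp
    have a2 : s / 2 - (n : ℝ) / 2 - 1 = (s / 2 - 1) + -((n : ℝ) / 2) := by ring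
    have a3 : s / 2 - 1 - (n : ℝ) / 2 = (s / 2 - 1) + -((n : ℝ) / 2) := by ring
    rw [a1, a2, a3, Real.rpow_add ht0, Real.rpow_add hr, Real.mul_rpow ht0.le hr.le,
      Real.mul_rpow (by positivity) (by positivity), Real.mul_rpow ht0.le hr.le]
    ring
  have e3 : ENNReal.ofReal r * ENNReal.ofReal (r ^ (s / 2 - 1 - (n : ℝ) / 2)) ≤
      ∏ i, ENNReal.ofReal |z i| ^ (s / n - 1) := by
    set b := (1 - s / n) / 2 with hb
    have hb0 : 0 ≤ b := by
      have : s / n ≤ 1 := (div_le_one hn0).2 hsn.le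
      rw [hb]; linarith
    have c1 : ENNReal.ofReal r * ENNReal.ofReal (r ^ (s / 2 - 1 - (n : ℝ) / 2))
        = ∏ _i : Fin n, ENNReal.ofReal r ^ (-b) := by
      rw [Finset.prod_const, Finset.card_univ, Fintype.card_fin, ← ENNReal.rpow_natCast,
        ← ENNReal.rpow_mul, ← ENNReal.ofReal_mul hr.le, ENNReal.ofReal_rpow_of_pos hr]
      congr 1
      nth_rewrite 1 [← Real.rpow_one r]
      rw [← Real.rpow_add hr]
      congr 1
      rw [hb]; field_simp; ring
    rw [c1]
    refine Finset.prod_le_prod' fun i _ => ?_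
    have c2 : ENNReal.ofReal |z i| ^ (s / n - 1) = (ENNReal.ofReal (z i ^ 2)) ^ (-b) := by
      rw [← sq_abs, ENNReal.ofReal_pow (abs_nonneg _), ← ENNReal.rpow_natCast, ← ENNReal.rpow_mul]
      congr 1
      rw [hb]; push_cast; ring
    rw [c2]
    refine hs_rpow_neg_anti (ENNReal.ofReal_le_ofReal ?_) hb0
    exact Finset.single_le_sum (f := fun i => z i ^ 2) (fun i _ => sq_nonneg _) (Finset.mem_univ i)
  rw [e1, e2, ENNReal.ofReal_mul (by positivity)]
  calc _ = ENNReal.ofReal ((4 * π) ^ (-((n : ℝ) / 2))) *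
      (∫⁻ u in Ioi (0 : ℝ), ENNReal.ofReal (u ^ (s / 2 - (n : ℝ) / 2 - 1) * Real.exp (-(1 / (4 * u))))) *
      (ENNReal.ofReal r * ENNReal.ofReal (r ^ (s / 2 - 1 - (n : ℝ) / 2))) := by ring
    _ ≤ _ := mul_le_mul' le_rfl e3

theorem hs_riesz {n : ℕ} (hn : 1 ≤ n) {s : ℝ} (hs : 0 < s) (hsn : s < n) :
    ∃ C : ℝ≥0∞, C ≠ ∞ ∧ ∀ φ : (Fin n → ℝ) → ℂ, Continuous φ → Integrable φ →
      Integrable (fun ξ => ((hsSq ξ ^ (s / 2) : ℝ) : ℂ) * φ ξ) → ∀ x : Fin n → ℝ,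
      ‖∫ ξ, hsE x ξ * φ ξ‖ₑ ≤ C * ∫⁻ y, (∏ i, ENNReal.ofReal |x i - y i| ^ (s / n - 1)) *
        ‖∫ ξ, hsE y ξ * (((hsSq ξ ^ (s / 2) : ℝ) : ℂ) * φ ξ)‖ₑ := by
  obtain ⟨C, hC, hC3⟩ := hs_claim3 hn hsn
  have hΓ : 0 < Real.Gamma (s / 2) := Real.Gamma_pos_of_pos (by positivity)
  have hΓ0 : ENNReal.ofReal (Real.Gamma (s / 2)) ≠ 0 := by simpa using hΓ
  refine ⟨(ENNReal.ofReal (Real.Gamma (s / 2)))⁻¹ * C,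
    ENNReal.mul_ne_top (ENNReal.inv_ne_top.2 hΓ0) hC, fun φ hc hi hi2 x => ?_⟩
  have : Nonempty (Fin n) := ⟨⟨0, hn⟩⟩
  set h : (Fin n → ℝ) → ℂ := fun ξ => ((hsSq ξ ^ (s / 2) : ℝ) : ℂ) * φ ξ with hh
  have hhc : Continuous h := by
    refine (Complex.continuous_ofReal.comp ?_).mul hc
    exact hsSq_cont.rpow_const fun _ => Or.inr (by positivity)
  set Ψ : (Fin n → ℝ) → ℝ≥0∞ := fun y => ‖∫ ξ, hsE y ξ * h ξ‖ₑ with hΨ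
  have hΨm : Measurable Ψ := by
    have : StronglyMeasurable (Function.uncurry fun y ξ : Fin n → ℝ => hsE y ξ * h ξ) :=
      (hsE_cont.mul (hhc.comp continuous_snd)).stronglyMeasurable
    exact this.integral_prod_right.measurable.enorm
  have h2 := hs_claim2 hn hs φ hc hi x
  have h3 : ENNReal.ofReal (Real.Gamma (s / 2)) * ‖∫ ξ, hsE x ξ * φ ξ‖ₑ ≤
      ∫⁻ t in Ioi (0 : ℝ), ∫⁻ y, ENNReal.ofReal (t ^ (s / 2 - 1)) *
        (ENNReal.ofReal ((4 * π * t) ^ (-((n : ℝ) / 2))) *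
          ENNReal.ofReal (Real.exp (-(1 / (4 * t)) * hsSq (x - y)))) * Ψ y := by
    have e : ENNReal.ofReal (Real.Gamma (s / 2)) * ‖∫ ξ, hsE x ξ * φ ξ‖ₑ
      = ‖((Real.Gamma (s / 2) : ℝ) : ℂ) * ∫ ξ, hsE x ξ * φ ξ‖ₑ := by
      rw [enorm_mul, ← ofReal_norm ((Real.Gamma (s / 2) : ℝ) : ℂ), Complex.norm_of_nonneg hΓ.le]
    rw [e, h2]
    refine (enorm_integral_le_lintegral_enorm _).trans ?_
    refine setLIntegral_mono' measurableSet_Ioi fun t ht => ?_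
    have ht0 : (0 : ℝ) < t := ht
    rw [enorm_mul, ← ofReal_norm ((t ^ (s / 2 - 1) : ℝ) : ℂ), Complex.norm_of_nonneg (by positivity)]
    refine (mul_le_mul' le_rfl (hs_claim1_norm h hi2 ht0 x)).trans ?_
    rw [← lintegral_const_mul' _ _ ENNReal.ofReal_ne_top, ← lintegral_const_mul' _ _ ENNReal.ofReal_ne_top]
    refine le_of_eq (lintegral_congr fun y => ?_)
    ring
  have hm : Measurable (Function.uncurry fun (t : ℝ) (y : Fin n → ℝ) => ENNReal.ofReal (t ^ (s / 2 - 1)) *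
        (ENNReal.ofReal ((4 * π * t) ^ (-((n : ℝ) / 2))) *
          ENNReal.ofReal (Real.exp (-(1 / (4 * t)) * hsSq (x - y)))) * Ψ y) := by
    have g1 : Measurable fun z : ℝ × (Fin n → ℝ) => hsSq (x - z.2) :=
      hsSq_cont.measurable.comp (measurable_const.sub measurable_snd)
    have g2 : Measurable fun z : ℝ × (Fin n → ℝ) => Ψ z.2 := hΨm.comp measurable_snd
    simp only [Function.uncurry_def]
    fun_prop
  rw [lintegral_lintegral_swap hm.aemeasurable] at h3
  have hne : ∀ᵐ y : Fin n → ℝ, x - y ≠ 0 := by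
    have : ∀ᵐ y : Fin n → ℝ, y ≠ x := by simp [ae_iff]
    filter_upwards [this] with y hy hxy
    exact hy (sub_eq_zero.1 hxy).symm
  have h4 : ENNReal.ofReal (Real.Gamma (s / 2)) * ‖∫ ξ, hsE x ξ * φ ξ‖ₑ ≤
      C * ∫⁻ y, (∏ i, ENNReal.ofReal |x i - y i| ^ (s / n - 1)) * Ψ y := by
    refine h3.trans ?_
    rw [← lintegral_const_mul' _ _ hC]
    refine lintegral_mono_ae ?_
    filter_upwards [hne] with y hy
    have hmm : Measurable fun t : ℝ => ENNReal.ofReal (t ^ (s / 2 - 1)) *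
        (ENNReal.ofReal ((4 * π * t) ^ (-((n : ℝ) / 2))) *
          ENNReal.ofReal (Real.exp (-(1 / (4 * t)) * hsSq (x - y)))) := by fun_prop
    rw [lintegral_mul_const _ hmm, ← mul_assoc]
    exact mul_le_mul' (hC3 (x - y) hy) le_rfl
  calc ‖∫ ξ, hsE x ξ * φ ξ‖ₑ = (ENNReal.ofReal (Real.Gamma (s / 2)))⁻¹ *
        (ENNReal.ofReal (Real.Gamma (s / 2)) * ‖∫ ξ, hsE x ξ * φ ξ‖ₑ) := by
        rw [← mul_assoc, ENNReal.inv_mul_cancel hΓ0 ENNReal.ofReal_ne_top, one_mul]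
    _ ≤ _ := by
        rw [mul_assoc]
        exact mul_le_mul' le_rfl h4

open FourierTransform in
theorem hs_fourier (n : ℕ) (f : SchwartzMap (Fin n → ℝ) ℂ) :
    (∃ φ : SchwartzMap (Fin n → ℝ) ℂ, ft n f = φ) ∧
    ∀ x, f x = (((2 * π) ^ (-(n : ℝ) / 2) : ℝ) : ℂ) * ∫ ξ, hsE x ξ * ft n f ξ := by
  set c : ℝ := (2 * π) ^ (-(n : ℝ) / 2) with hc
  have h2pi : (0 : ℝ) < 2 * π := by positivity
  let V := EuclideanSpace ℝ (Fin n)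
  let F : SchwartzMap V ℂ := SchwartzMap.compCLMOfContinuousLinearEquiv ℂ (EuclideanSpace.equiv (Fin n) ℝ) f
  have hF : ∀ v : V, F v = f v.ofLp := fun v => rfl
  let G : SchwartzMap V ℂ := 𝓕 F
  let u : ℝˣ := Units.mk0 (2 * π)⁻¹ (by positivity)
  let G1 : SchwartzMap (Fin n → ℝ) ℂ :=
    SchwartzMap.compCLMOfContinuousLinearEquiv ℂ (EuclideanSpace.equiv (Fin n) ℝ).symm G
  let G2 : SchwartzMap (Fin n → ℝ) ℂ :=
    SchwartzMap.compCLMOfContinuousLinearEquiv ℂ (ContinuousLinearEquiv.smulLeft u) G1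
  have hG1 : ∀ ξ, G1 ξ = G (WithLp.toLp 2 ξ) := fun ξ => rfl
  have hG2 : ∀ ξ, G2 ξ = G1 ((2 * π)⁻¹ • ξ) := fun ξ => rfl
  have hemb : MeasurableEmbedding (@WithLp.toLp 2 (Fin n → ℝ)) :=
    (MeasurableEquiv.toLp 2 (Fin n → ℝ)).measurableEmbedding
  have hcov : ∀ g : V → ℂ, ∫ v : V, g v = ∫ y : Fin n → ℝ, g (WithLp.toLp 2 y) := fun g =>
    ((PiLp.volume_preserving_toLp (Fin n)).integral_comp hemb g).symm
  have h1 : ∀ ξ, ft n f ξ = (c : ℂ) * G2 ξ := by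
    intro ξ
    rw [hG2, hG1]
    have : G (WithLp.toLp 2 ((2 * π)⁻¹ • ξ)) = 𝓕 (F : V → ℂ) (WithLp.toLp 2 ((2 * π)⁻¹ • ξ)) := rfl
    rw [this, Real.fourier_eq', hcov]
    unfold ft
    congr 1
    refine integral_congr_ae (Filter.Eventually.of_forall fun y => ?_)
    simp only [smul_eq_mul]
    congr 1
    congr 1
    have e : (-2 * π * inner ℝ (WithLp.toLp 2 y : V) (WithLp.toLp 2 ((2 * π)⁻¹ • ξ) : V))
        = -∑ i, ξ i * y i := by
      rw [PiLp.inner_apply, Finset.mul_sum, ← Finset.sum_neg_distrib]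
      refine Finset.sum_congr rfl fun i _ => ?_
      simp
      field_simp
    rw [e]
    push_cast; ring
  have hφ : ft n f = ((c : ℂ) • G2 : SchwartzMap (Fin n → ℝ) ℂ) := by
    funext ξ
    rw [h1]; rfl
  refine ⟨⟨_, hφ⟩, fun x => ?_⟩
  have hinv : 𝓕⁻ G = F := FourierTransform.fourierInv_fourier_eq F
  have h3 : f x = 𝓕⁻ (G : V → ℂ) (WithLp.toLp 2 x) := by
    rw [← SchwartzMap.fourierInv_coe, hinv]; rfl
  rw [h3, Real.fourierInv_eq', hcov]
  have h4 : ∀ y : Fin n → ℝ, Complex.exp (((2 * π * inner ℝ (WithLp.toLp 2 y : V) (WithLp.toLp 2 x : V) : ℝ) : ℂ) * Complex.I)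
      • G (WithLp.toLp 2 y) = (fun ξ => hsE x ξ * G2 ξ) ((2 * π) • y) := by
    intro y
    simp only [smul_eq_mul]
    rw [hG2, hG1, smul_smul, inv_mul_cancel₀ h2pi.ne', one_smul]
    congr 1
    unfold hsE
    congr 1
    have e : (2 * π * inner ℝ (WithLp.toLp 2 y : V) (WithLp.toLp 2 x : V))
        = -∑ i, (-x) i * ((2 * π) • y) i := by
      rw [PiLp.inner_apply, Finset.mul_sum, ← Finset.sum_neg_distrib]
      refine Finset.sum_congr rfl fun i _ => ?_
      simp
      ring
    rw [e]
    push_cast; ring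
  simp_rw [h4]
  rw [Measure.integral_comp_smul volume (fun ξ => hsE x ξ * G2 ξ) (2 * π)]
  simp_rw [h1]
  have h5 : ∀ ξ, hsE x ξ * ((c : ℂ) * G2 ξ) = (c : ℂ) * (hsE x ξ * G2 ξ) := fun ξ => by ring
  simp_rw [h5]
  rw [integral_const_mul, ← mul_assoc, Complex.real_smul]
  congr 1
  rw [← Complex.ofReal_mul]
  congr 1
  rw [hc, ← Real.rpow_add h2pi, Module.finrank_fin_fun, abs_of_pos (by positivity),
    ← Real.rpow_natCast, ← Real.rpow_neg h2pi.le]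
  congr 1
  ring

theorem hs_mult_int {n : ℕ} {s : ℝ} (hs : 0 < s) (φ : SchwartzMap (Fin n → ℝ) ℂ) :
    Integrable (fun ξ => ((hsSq ξ ^ (s / 2) : ℝ) : ℂ) * φ ξ) := by
  obtain ⟨k, hk⟩ := exists_nat_ge s
  have hi : Integrable fun ξ : Fin n → ℝ => (n : ℝ) ^ (s / 2) * (‖φ ξ‖ + ‖ξ‖ ^ k * ‖φ ξ‖) :=
    (φ.integrable.norm.add (φ.integrable_pow_mul volume k)).const_mul _
  refine hi.mono' ?_ (Filter.Eventually.of_forall fun ξ => ?_)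
  · have : Continuous fun ξ : Fin n → ℝ => ((hsSq ξ ^ (s / 2) : ℝ) : ℂ) * φ ξ :=
      (Complex.continuous_ofReal.comp
        (hsSq_cont.rpow_const fun _ => Or.inr (by positivity))).mul φ.continuous
    exact this.aestronglyMeasurable
  · have hq := hsSq_nonneg ξ
    rw [norm_mul, Complex.norm_of_nonneg (by positivity)]
    have e1 : hsSq ξ ≤ n * ‖ξ‖ ^ 2 := by
      unfold hsSq
      calc ∑ i, ξ i ^ 2 ≤ ∑ _i : Fin n, ‖ξ‖ ^ 2 := by
            refine Finset.sum_le_sum fun i _ => ?_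
            rw [← sq_abs]
            exact pow_le_pow_left₀ (abs_nonneg _) (norm_le_pi_norm ξ i) 2
        _ = _ := by simp
    have e2 : hsSq ξ ^ (s / 2) ≤ (n : ℝ) ^ (s / 2) * ‖ξ‖ ^ s := by
      refine (Real.rpow_le_rpow hq e1 (by positivity)).trans (le_of_eq ?_)
      rw [Real.mul_rpow (by positivity) (by positivity), ← Real.rpow_natCast, ← Real.rpow_mul (norm_nonneg _)]
      congr 2
      push_cast; ring
    have e3 : ‖ξ‖ ^ s ≤ 1 + ‖ξ‖ ^ k := by
      rcases le_total ‖ξ‖ 1 with h | h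
      · have := Real.rpow_le_one (norm_nonneg ξ) h hs.le
        have := pow_nonneg (norm_nonneg ξ) k
        linarith
      · have := Real.rpow_le_rpow_of_exponent_le h hk
        rw [Real.rpow_natCast] at this
        linarith
    calc hsSq ξ ^ (s / 2) * ‖φ ξ‖ ≤ ((n : ℝ) ^ (s / 2) * (1 + ‖ξ‖ ^ k)) * ‖φ ξ‖ := by
          gcongr
          exact e2.trans (by gcongr)
      _ = _ := by ring

theorem hs_weight {n : ℕ} (hn : 1 ≤ n) {s : ℝ} (hs : 0 < s) {x : Fin n → ℝ} (hx : ∀ i, x i ≠ 0) :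
    ‖((((hsSq x) ^ (s / 2) : ℝ)) : ℂ)⁻¹‖ₑ ≤ ∏ i, ENNReal.ofReal |x i| ^ (-(s / n)) := by
  have hn0 : (0 : ℝ) < n := by exact_mod_cast hn
  have hx0 : x ≠ 0 := fun h => hx ⟨0, hn⟩ (by rw [h]; rfl)
  have hr := hsSq_pos hx0
  have e1 : ‖((((hsSq x) ^ (s / 2) : ℝ)) : ℂ)⁻¹‖ₑ = ∏ _i : Fin n, ENNReal.ofReal (hsSq x) ^ (-(s / n / 2)) := by
    rw [Finset.prod_const, Finset.card_univ, Fintype.card_fin, ← ENNReal.rpow_natCast,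
        ← ENNReal.rpow_mul, ENNReal.ofReal_rpow_of_pos hr, ← Complex.ofReal_inv, ← ofReal_norm,
        Complex.norm_of_nonneg (by positivity), ← Real.rpow_neg hr.le]
    congr 2
    field_simp
  rw [e1]
  refine Finset.prod_le_prod' fun i _ => ?_
  have c2 : ENNReal.ofReal |x i| ^ (-(s / n)) = (ENNReal.ofReal (x i ^ 2)) ^ (-(s / n / 2)) := by
    rw [← sq_abs, ENNReal.ofReal_pow (abs_nonneg _), ← ENNReal.rpow_natCast, ← ENNReal.rpow_mul]
    congr 1
    push_cast; ring
  rw [c2]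
  refine hs_rpow_neg_anti (ENNReal.ofReal_le_ofReal ?_) (by positivity)
  exact Finset.single_le_sum (f := fun i => x i ^ 2) (fun i _ => sq_nonneg _) (Finset.mem_univ i)

theorem hs_pointwise {n : ℕ} (hn : 1 ≤ n) {s : ℝ} (hs : 0 < s) (hsn : s < n) :
    ∃ C : ℝ≥0∞, C ≠ 0 ∧ C ≠ ∞ ∧ ∀ f : SchwartzMap (Fin n → ℝ) ℂ,
      Measurable (fun y => (‖fracLap n s f y‖₊ : ℝ≥0∞)) ∧
      ∀ x : Fin n → ℝ, (∀ i, x i ≠ 0) →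
      (‖f x / ((((∑ i, x i ^ 2) ^ (s / 2) : ℝ)) : ℂ)‖₊ : ℝ≥0∞) ≤
        C * ((∏ i, ENNReal.ofReal |x i| ^ (-(s / n))) *
          ∫⁻ y, (∏ i, ENNReal.ofReal |x i - y i| ^ (s / n - 1)) * (‖fracLap n s f y‖₊ : ℝ≥0∞)) := by
  obtain ⟨C, hC, hR⟩ := hs_riesz hn hs hsn
  refine ⟨C + 1, by simp, by simp [hC], fun f => ?_⟩
  obtain ⟨⟨φ, hφ⟩, hinv⟩ := hs_fourier n f
  have hΛ : ∀ y, fracLap n s f y = (((2 * π) ^ (-(n : ℝ) / 2) : ℝ) : ℂ) *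
      ∫ ξ, hsE y ξ * (((hsSq ξ ^ (s / 2) : ℝ) : ℂ) * φ ξ) := by
    intro y
    rw [← hφ]
    rfl
  rw [hφ] at hinv
  set c := (((2 * π) ^ (-(n : ℝ) / 2) : ℝ) : ℂ)
  have hcont : Continuous fun ξ : Fin n → ℝ => ((hsSq ξ ^ (s / 2) : ℝ) : ℂ) * φ ξ :=
      (Complex.continuous_ofReal.comp
        (hsSq_cont.rpow_const fun _ => Or.inr (by positivity))).mul φ.continuous
  refine ⟨?_, fun x hx => ?_⟩
  · have h1 : StronglyMeasurable (Function.uncurry fun y ξ : Fin n → ℝ =>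
        hsE y ξ * (((hsSq ξ ^ (s / 2) : ℝ) : ℂ) * φ ξ)) :=
      (hsE_cont.mul (hcont.comp continuous_snd)).stronglyMeasurable
    simp_rw [hΛ]
    exact (h1.integral_prod_right.measurable.const_mul c).enorm
  · have h2 := hR φ φ.continuous φ.integrable (hs_mult_int hs φ) x
    change ‖f x / (((hsSq x ^ (s / 2) : ℝ)) : ℂ)‖ₑ ≤ (C + 1) * ((∏ i, ENNReal.ofReal |x i| ^ (-(s / n))) *
          ∫⁻ y, (∏ i, ENNReal.ofReal |x i - y i| ^ (s / n - 1)) * ‖fracLap n s f y‖ₑ)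
    have h3 : ‖f x‖ₑ ≤ C * ∫⁻ y, (∏ i, ENNReal.ofReal |x i - y i| ^ (s / n - 1)) * ‖fracLap n s f y‖ₑ := by
      have e : ∀ y, (∏ i, ENNReal.ofReal |x i - y i| ^ (s / n - 1)) * ‖fracLap n s f y‖ₑ
          = ‖c‖ₑ * ((∏ i, ENNReal.ofReal |x i - y i| ^ (s / n - 1)) *
            ‖∫ ξ, hsE y ξ * (((hsSq ξ ^ (s / 2) : ℝ) : ℂ) * φ ξ)‖ₑ) := fun y => by
        rw [hΛ, enorm_mul]; ring
      simp_rw [e]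
      rw [lintegral_const_mul' _ _ enorm_ne_top, hinv x, enorm_mul, mul_left_comm]
      exact mul_le_mul' le_rfl h2
    rw [div_eq_mul_inv, enorm_mul, mul_left_comm, mul_comm]
    refine mul_le_mul' (hs_weight hn hs hx) (h3.trans (mul_le_mul' le_self_add le_rfl))

/-- **Anisotropic Hardy–Sobolev inequality in mixed Lorentz spaces.**
If `1 < pᵢ, qᵢ < ∞` and `0 < s < n/pᵢ` for all `i`, then
`‖ f(x)/|x|^s ‖_{L^{p⃗,q⃗}(ℝⁿ)} ≤ C ‖ Λ^s f ‖_{L^{p⃗,q⃗}(ℝⁿ)}` for all Schwartz `f`. -/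
theorem anisotropic_hardy_sobolev_mixed_lorentz
    (n : ℕ) (hn : 1 ≤ n) (p q : Fin n → ℝ)
    (hp : ∀ i, 1 < p i) (hq : ∀ i, 1 < q i)
    (s : ℝ) (hs : 0 < s) (hsn : ∀ i, s < n / p i) :
    ∃ C : ℝ, 0 < C ∧ ∀ f : SchwartzMap ((Fin n) → ℝ) ℂ,
      mixedLorentz n (fun i => ENNReal.ofReal (p i)) (fun i => ENNReal.ofReal (q i))
        (fun x => (‖f x / ((((∑ i, x i ^ 2) ^ (s / 2) : ℝ)) : ℂ)‖₊ : ℝ≥0∞))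
      ≤ ENNReal.ofReal C *
        mixedLorentz n (fun i => ENNReal.ofReal (p i)) (fun i => ENNReal.ofReal (q i))
          (fun x => (‖fracLap n s (⇑f) x‖₊ : ℝ≥0∞)) := by
  have hn0 : (0 : ℝ) < n := by exact_mod_cast hn
  have hap : ∀ i, s / n < 1 / p i := by
    intro i
    have hpi : 0 < p i := by linarith [hp i]
    have h := hsn i
    rw [lt_div_iff₀ hpi] at h
    rw [div_lt_div_iff₀ hn0 hpi]
    linarith
  have hsn' : s < n := by
    have i : Fin n := ⟨0, hn⟩
    refine (hsn i).trans_le ?_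
    exact div_le_self hn0.le (hp i).le
  obtain ⟨C0, hC00, hC0, hpt⟩ := hs_pointwise hn hs hsn'
  obtain ⟨K, hK, hker⟩ := hs_main_kernel n p q hp hq (s / n) (by positivity) hap
  refine ⟨(C0 * K).toReal + 1, by positivity, fun f => ?_⟩
  obtain ⟨hm, hx⟩ := hpt f
  have h1 := hsML_mono n p q hp hq _ _ hx
  rw [hsML_const n p q hp hq C0 hC00 hC0] at h1
  have h2 := h1.trans (mul_le_mul' le_rfl (hker _ hm))
  refine (show _ ≤ _ from h2).trans ?_
  rw [← mul_assoc]
  refine mul_le_mul' ?_ le_rfl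
  rw [← ENNReal.ofReal_toReal (ENNReal.mul_ne_top hC0 hK)]
  exact ENNReal.ofReal_le_ofReal (by simp)
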